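/- Let G be a finite simple graph that is (P₂ ∪ P₄, HVN)-free. Then: if ω(G) = 2 then χ(G) ≤ 4; if ω(G) = 3 then χ(G) ≤ 10; and if ω(G) ≥ 4 then χ(G) ≤ ⌈(4/3)·ω(G)⌉. -/

import Mathlib

open SimpleGraph

/-- `P₂ ∪ P₄`: the disjoint union of a path on 2 vertices (vertices 0,1) and a
path on 4 vertices (vertices 2,3,4,5). -/
def P2P4 : SimpleGraph (Fin 6) :=
  SimpleGraph.fromEdgeSet {s(0, 1), s(2, 3), s(3, 4), s(4, 5)}

/-- The HVN: `K₅` minus two edges incident to a common vertex; `{0,1,2,3}` is a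
clique and vertex `4` is adjacent exactly to `0` and `1`. -/
def HVN : SimpleGraph (Fin 5) :=
  SimpleGraph.fromEdgeSet
    {s(0, 1), s(0, 2), s(0, 3), s(1, 2), s(1, 3), s(2, 3), s(4, 0), s(4, 1)}

/-- A graph `G` is `H`-free if it has no induced subgraph isomorphic to `H`,
i.e. there is no graph embedding of `H` into `G`. -/
def IsFree {W V : Type*} (G : SimpleGraph V) (H : SimpleGraph W) : Prop :=
  IsEmpty (H ↪g G)

section Structure

variable {V : Type*} {G : SimpleGraph V}

/-- The two forbidden induced subgraphs, spelled out on explicit vertices: every induced `P₄`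
dominates every edge, and no vertex has exactly two neighbours in a `K₄`. -/
structure Good (G : SimpleGraph V) : Prop where
  dominates : ∀ a b c d e f, G.Adj a b → G.Adj b c → G.Adj c d → ¬G.Adj a c → ¬G.Adj a d →
    ¬G.Adj b d → G.Adj e f → ¬G.Adj a e → ¬G.Adj b e → ¬G.Adj c e → ¬G.Adj d e →
    ¬G.Adj a f → ¬G.Adj b f → ¬G.Adj c f → ¬G.Adj d f → False
  hvn : ∀ a b c d v, G.Adj a b → G.Adj a c → G.Adj a d → G.Adj b c → G.Adj b d → G.Adj c d →
    G.Adj v a → G.Adj v b → ¬G.Adj v c → ¬G.Adj v d → False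

/-- A map preserving and reflecting adjacency is an embedding when the source has no two vertices
with the same neighbourhood. -/
theorem IsFree.false_of_adj_iff {W : Type*} {H : SimpleGraph W} (h : IsFree G H)
    (hH : ∀ i j, (∀ k, H.Adj i k ↔ H.Adj j k) → i = j) (f : W → V)
    (hf : ∀ i j, H.Adj i j ↔ G.Adj (f i) (f j)) : False :=
  h.false ⟨⟨f, fun i j hij => hH i j fun k => by rw [hf, hf, hij]⟩, (hf _ _).symm⟩

theorem Good.of_isFree (h1 : IsFree G P2P4) (h2 : IsFree G HVN) : Good G where
  dominates a b c d e f ab bc cd ac ad bd ef ae be ce de af bf cf df := by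
    refine h1.false_of_adj_iff ?_ ![e, f, a, b, c, d] fun i j => ?_
    · simp only [P2P4, SimpleGraph.fromEdgeSet_adj, Set.mem_insert_iff, Set.mem_singleton_iff]
      decide
    · fin_cases i <;> fin_cases j <;>
        simp [P2P4, ab, bc, cd, ac, ad, bd, ef, ae, be, ce, de, af, bf, cf, df,
          ab.symm, bc.symm, cd.symm, ef.symm, mt Adj.symm ac, mt Adj.symm ad, mt Adj.symm bd,
          mt Adj.symm ae, mt Adj.symm be, mt Adj.symm ce, mt Adj.symm de, mt Adj.symm af,
          mt Adj.symm bf,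
          mt Adj.symm cf, mt Adj.symm df]
  hvn a b c d v ab ac ad bc bd cd va vb vc vd := by
    refine h2.false_of_adj_iff ?_ ![a, b, c, d, v] fun i j => ?_
    · simp only [HVN, SimpleGraph.fromEdgeSet_adj, Set.mem_insert_iff, Set.mem_singleton_iff]
      decide
    · fin_cases i <;> fin_cases j <;>
        simp [HVN, ab, ac, ad, bc, bd, cd, va, vb, vc, vd, ab.symm, ac.symm, ad.symm, bc.symm,
          bd.symm, cd.symm, va.symm, vb.symm, mt Adj.symm vc, mt Adj.symm vd]

theorem Good.exists_adj_of_P4 (hG : Good G) {a b c d e f : V} (ab : G.Adj a b) (bc : G.Adj b c)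
    (cd : G.Adj c d) (ac : ¬G.Adj a c) (ad : ¬G.Adj a d) (bd : ¬G.Adj b d) (ef : G.Adj e f) :
    (G.Adj a e ∨ G.Adj b e ∨ G.Adj c e ∨ G.Adj d e) ∨
      G.Adj a f ∨ G.Adj b f ∨ G.Adj c f ∨ G.Adj d f := by
  by_contra! h
  obtain ⟨⟨ae, be, ce, de⟩, af, bf, cf, df⟩ := h
  exact hG.dominates a b c d e f ab bc cd ac ad bd ef ae be ce de af bf cf df

end Structure

section Cograph

variable {V κ : Type*} {G : SimpleGraph V}

open scoped Classical in
/-- A `P₄`-free vertex set all of whose cliques have at most `#L` vertices is `L`-colourable. -/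
theorem exists_coloring_of_P4_free [Nonempty κ] (L : Finset κ) (W : Finset V)
    (hP : ∀ a ∈ W, ∀ b ∈ W, ∀ c ∈ W, ∀ d ∈ W, G.Adj a b → G.Adj b c → G.Adj c d → ¬G.Adj a c →
      ¬G.Adj a d → ¬G.Adj b d → False)
    (hK : ∀ K ⊆ W, G.IsClique (K : Set V) → K.card ≤ L.card) :
    ∃ f : V → κ, (∀ v ∈ W, f v ∈ L) ∧ ∀ v ∈ W, ∀ w ∈ W, G.Adj v w → f v ≠ f w := by
  induction L using Finset.induction generalizing W with
  | empty =>
    have hW : ∀ v, v ∉ W := fun v hv => by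
      have := hK {v} (by simpa using hv) (by simp)
      simp at this
    exact ⟨fun _ => Classical.arbitrary κ, fun v hv => absurd hv (hW v),
      fun v hv => absurd hv (hW v)⟩
  | insert c L hc ih =>
    rw [Finset.card_insert_of_notMem hc] at hK
    obtain ⟨S, hS, hmax⟩ := Finset.exists_max_image
      (W.powerset.filter fun S => ∀ v ∈ S, ∀ w ∈ S, ¬G.Adj v w) Finset.card ⟨∅, by simp⟩
    simp only [Finset.mem_filter, Finset.mem_powerset] at hS hmax
    obtain ⟨hSW, hSi⟩ := hS
    have hnb : ∀ k ∈ W \ S, ∃ s ∈ S, G.Adj s k := by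
      intro k hk
      rw [Finset.mem_sdiff] at hk
      by_contra! h
      have := hmax (insert k S) ⟨Finset.insert_subset hk.1 hSW, by
        simp only [Finset.mem_insert]
        rintro v (rfl | hv) w (rfl | hw)
        · simp
        · exact fun h' => h w hw h'.symm
        · exact h v hv
        · exact hSi v hv w hw⟩
      rw [Finset.card_insert_of_notMem hk.2] at this
      omega
    obtain ⟨f, hfL, hf⟩ := ih (W \ S)
      (fun a ha b hb c hc d hd => hP a (Finset.sdiff_subset ha) b (Finset.sdiff_subset hb) c
        (Finset.sdiff_subset hc) d (Finset.sdiff_subset hd)) fun K hKW hKc => by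
      by_contra! hcard
      have hnn : ∀ s ∈ S, ∃ k ∈ K, ¬G.Adj s k := by
        intro s hs
        by_contra! h
        have := hK (insert s K)
          (Finset.insert_subset (hSW hs) (hKW.trans Finset.sdiff_subset)) (by
            rw [Finset.coe_insert]
            exact hKc.insert fun b hb _ => h b hb)
        rw [Finset.card_insert_of_notMem fun hsK => (Finset.mem_sdiff.1 (hKW hsK)).2 hs] at this
        omega
      obtain ⟨k₀, hk₀⟩ : K.Nonempty := Finset.card_pos.1 (by omega)
      obtain ⟨s₀, hs₀, -⟩ := hnb k₀ (hKW hk₀)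
      obtain ⟨s, hs, hsmax⟩ := Finset.exists_max_image S
        (fun s => (K.filter fun k => G.Adj s k).card) ⟨s₀, hs₀⟩
      obtain ⟨k, hk, hsk⟩ := hnn s hs
      obtain ⟨s', hs', hs'k⟩ := hnb k (hKW hk)
      obtain ⟨k', hk', h1, h2⟩ : ∃ k' ∈ K, G.Adj s k' ∧ ¬G.Adj s' k' := by
        by_contra! h
        have : (K.filter fun k => G.Adj s k) ⊂ K.filter fun k => G.Adj s' k := by
          refine (Finset.ssubset_iff_of_subset fun x hx => ?_).2 ⟨k, ?_, ?_⟩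
          · rw [Finset.mem_filter] at hx ⊢
            exact ⟨hx.1, h x hx.1 hx.2⟩
          · simp [hk, hs'k]
          · simp [hsk]
        exact absurd (hsmax s' hs') (by simpa using Finset.card_lt_card this)
      have hkk : k' ≠ k := by rintro rfl; exact hsk h1
      exact hP s (hSW hs) k' (Finset.mem_sdiff.1 (hKW hk')).1 k (Finset.mem_sdiff.1 (hKW hk)).1 s'
        (hSW hs') h1 (hKc hk' hk hkk) hs'k.symm hsk (hSi s hs s' hs') fun h => h2 h.symm
    refine ⟨fun v => if v ∈ S then c else f v, fun v hv => ?_, fun v hv w hw hvw => ?_⟩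
    · by_cases hvS : v ∈ S
      · simp [hvS]
      · simp [hvS, hfL v (by simp [hv, hvS])]
    · by_cases hvS : v ∈ S <;> by_cases hwS : w ∈ S
      · exact absurd hvw (hSi v hvS w hwS)
      · simp only [hvS, hwS, if_true, if_false]
        rintro rfl
        exact hc (hfL w (by simp [hw, hwS]))
      · simp only [hvS, hwS, if_true, if_false]
        rintro rfl
        exact hc (hfL v (by simp [hv, hvS]))
      · simp only [hvS, hwS, if_false]
        exact hf v (by simp [hv, hvS]) w (by simp [hw, hwS]) hvw

theorem Good.exists_coloring [Nonempty κ] (hG : Good G) {e f : V} (hef : G.Adj e f) (L : Finset κ)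
    (W : Finset V) (hWe : ∀ w ∈ W, ¬G.Adj w e) (hWf : ∀ w ∈ W, ¬G.Adj w f)
    (hK : ∀ K ⊆ W, G.IsClique (K : Set V) → K.card ≤ L.card) :
    ∃ f : V → κ, (∀ v ∈ W, f v ∈ L) ∧ ∀ v ∈ W, ∀ w ∈ W, G.Adj v w → f v ≠ f w :=
  exists_coloring_of_P4_free L W (fun a ha b hb c hc d hd ab bc cd ac ad bd =>
    hG.dominates a b c d e f ab bc cd ac ad bd hef (hWe a ha) (hWe b hb) (hWe c hc) (hWe d hd)
      (hWf a ha) (hWf b hb) (hWf c hc) (hWf d hd)) hK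

open scoped Classical in
/-- Colour the vertices satisfying `P` and the others separately; among the others, adjacent
vertices have the same type, and each type is coloured on its own. -/
theorem exists_coloring_of_types {τ : Type*} (N : Set V) (ty : V → τ) (P : V → Prop)
    (L : V → Finset κ) (hP : ∀ v ∈ N, ∀ w ∈ N, G.Adj v w → P v → P w)
    (hty : ∀ v ∈ N, ∀ w ∈ N, G.Adj v w → ¬P v → ty v = ty w)
    (h₀ : ∃ f : V → κ, ∀ v ∈ N, P v → f v ∈ L v ∧ ∀ w ∈ N, P w → G.Adj v w → f v ≠ f w)
    (h₁ : ∀ t, ∃ f : V → κ, ∀ v ∈ N, ty v = t →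
      f v ∈ L v ∧ ∀ w ∈ N, ty w = t → G.Adj v w → f v ≠ f w) :
    ∃ f : V → κ, ∀ v ∈ N, f v ∈ L v ∧ ∀ w ∈ N, G.Adj v w → f v ≠ f w := by
  obtain ⟨f, hf⟩ := h₀
  choose g hg using h₁
  refine ⟨fun v => if P v then f v else g (ty v) v, fun v hv => ?_⟩
  by_cases hPv : P v
  · simp only [hPv, if_true]
    refine ⟨(hf v hv hPv).1, fun w hw hvw => ?_⟩
    have hPw := hP v hv w hw hvw hPv
    simp only [hPw, if_true]
    exact (hf v hv hPv).2 w hw hPw hvw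
  · simp only [hPv, if_false]
    refine ⟨(hg _ v hv rfl).1, fun w hw hvw => ?_⟩
    have hPw : ¬P w := fun h => hPv (hP w hw v hv hvw.symm h)
    simp only [hPw, if_false]
    rw [← hty v hv w hw hvw hPv]
    exact (hg _ v hv rfl).2 w hw (hty v hv w hw hvw hPv).symm hvw

end Cograph

section Colorings

variable {V : Type*} {G : SimpleGraph V}

open scoped Classical in
theorem colorable_of_split {κ : Type*} [Fintype κ] (B : V → Prop) (g f : V → κ)
    (hg : ∀ u v, B u → B v → G.Adj u v → g u ≠ g v)
    (hf : ∀ u v, ¬B u → ¬B v → G.Adj u v → f u ≠ f v)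
    (hgf : ∀ u v, B u → ¬B v → G.Adj u v → g u ≠ f v) : G.Colorable (Fintype.card κ) := by
  refine (Coloring.mk (fun v => if B v then g v else f v) fun {u v} huv => ?_).colorable
  by_cases hu : B u <;> by_cases hv : B v <;> simp only [hu, hv, if_true, if_false]
  · exact hg u v hu hv huv
  · exact hgf u v hu hv huv
  · exact (hgf v u hv hu huv.symm).symm
  · exact hf u v hu hv huv

theorem colorable_of_classes {ι : Type*} [Fintype ι] (cls : V → ι) (n : ι → ℕ)
    (h : ∀ i, ∃ f : V → Fin (n i), ∀ v w, cls v = i → cls w = i → G.Adj v w → f v ≠ f w) :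
    G.Colorable (∑ i, n i) := by
  choose f hf using h
  have : G.Coloring (Σ i, Fin (n i)) := Coloring.mk (fun v => ⟨cls v, f (cls v) v⟩)
      fun {v w} hvw => by
    intro heq
    rw [Sigma.mk.injEq] at heq
    obtain ⟨h1, h2⟩ := heq
    rw [← h1] at h2
    exact hf (cls v) v w rfl h1.symm hvw (eq_of_heq h2)
  simpa using this.colorable

theorem exists_injOn_fin (X : Finset V) {n : ℕ} (hX : X.card ≤ n) (hn : 0 < n) :
    ∃ ρ : V → Fin n, Set.InjOn ρ (X : Set V) := by
  have : Nonempty (Fin n) := ⟨⟨0, hn⟩⟩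
  obtain ⟨f, -, hf⟩ := Set.Finite.exists_injOn_of_encard_le (s := (X : Set V))
    (t := Set.univ (α := Fin n)) X.finite_toSet (by simpa using hX)
  exact ⟨f, hf⟩

theorem Good.colorable_four [Fintype V] (hG : Good G) (h3 : G.CliqueFree 3) {u v : V}
    (huv : G.Adj u v) : G.Colorable 4 := by
  classical
  have h3' : ∀ a b c, G.Adj a b → G.Adj a c → G.Adj b c → False := fun a b c ab ac bc =>
    h3 {a, b, c} (is3Clique_triple_iff.2 ⟨ab, ac, bc⟩)
  refine colorable_of_classes
    (fun w => if G.Adj u w then (0 : Fin 3) else if G.Adj v w then 1 else 2)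
    ![1, 1, 2] fun i => ?_
  fin_cases i
  · refine ⟨fun _ => (0 : Fin 1), fun w z hw hz hwz => ?_⟩
    split_ifs at hw hz <;> simp at hw hz
    all_goals exact (h3' u w z (by tauto) (by tauto) hwz).elim
  · refine ⟨fun _ => (0 : Fin 1), fun w z hw hz hwz => ?_⟩
    split_ifs at hw hz <;> simp at hw hz
    exact (h3' v w z (by tauto) (by tauto) hwz).elim
  · obtain ⟨f, -, hf⟩ := hG.exists_coloring huv (Finset.univ : Finset (Fin 2))
      (Finset.univ.filter fun w => ¬G.Adj u w ∧ ¬G.Adj v w)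
      (by simp +contextual [G.adj_comm]) (by simp +contextual [G.adj_comm])
      (fun K _ hK => by
        by_contra! hc
        exact (h3.mono (by simp at hc; omega)) K ⟨hK, rfl⟩)
    refine ⟨f, fun w z hw hz hwz => hf w ?_ z ?_ hwz⟩
    · split_ifs at hw <;> simp_all
    · split_ifs at hz <;> simp_all

end Colorings

section Parts

variable {V : Type*} {G : SimpleGraph V} {X : Finset V} {a b x y u v : V}

/-- `X` is an inclusion-maximal clique with at least four vertices. -/
structure IsMaxClique (G : SimpleGraph V) (X : Finset V) : Prop where
  clique : G.IsClique (X : Set V)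
  four_le : 4 ≤ X.card
  exists_not_adj : ∀ v, ∃ x ∈ X, ¬G.Adj v x

/-- `IsTwin G X x v`: the vertex `v` is a twin of `x` with respect to the clique `X`. -/
def IsTwin (G : SimpleGraph V) (X : Finset V) (x v : V) : Prop :=
  x ∈ X ∧ ¬G.Adj v x ∧ ∀ y ∈ X, y ≠ x → G.Adj v y

/-- The vertex `v` is a twin of some vertex of `X`. -/
def HasTwin (G : SimpleGraph V) (X : Finset V) (v : V) : Prop :=
  ∃ x, IsTwin G X x v

/-- The vertex `v` has a neighbour among the twins of `x`. -/
def Touch (G : SimpleGraph V) (X : Finset V) (x v : V) : Prop :=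
  ∃ u, IsTwin G X x u ∧ G.Adj v u

theorem Finset.exists_mem_ne_ne_ne (hX : 4 ≤ X.card) (x y z : V) :
    ∃ a ∈ X, a ≠ x ∧ a ≠ y ∧ a ≠ z := by
  classical
  have : ({x, y, z} : Finset V).card < X.card := (Finset.card_le_three).trans_lt hX
  obtain ⟨a, ha, h⟩ := Finset.exists_mem_notMem_of_card_lt_card this
  simp only [Finset.mem_insert, Finset.mem_singleton, not_or] at h
  exact ⟨a, ha, h⟩

theorem Finset.exists_pair_mem_ne (hX : 4 ≤ X.card) (x y : V) :
    ∃ a ∈ X, ∃ b ∈ X, a ≠ b ∧ a ≠ x ∧ a ≠ y ∧ b ≠ x ∧ b ≠ y := by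
  obtain ⟨a, ha, hax, hay, -⟩ := Finset.exists_mem_ne_ne_ne hX x y y
  obtain ⟨b, hb, hba, hbx, hby⟩ := Finset.exists_mem_ne_ne_ne hX a x y
  exact ⟨a, ha, b, hb, hba.symm, hax, hay, hbx, hby⟩

theorem IsMaxClique.exists_superset [Fintype V] {K : Finset V} (hK : G.IsClique (K : Set V))
    (h4 : 4 ≤ K.card) : ∃ X, K ⊆ X ∧ IsMaxClique G X := by
  classical
  obtain ⟨X, hX, hmax⟩ := Finset.exists_max_image
    (Finset.univ.filter fun X : Finset V => K ⊆ X ∧ G.IsClique (X : Set V)) Finset.card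
    ⟨K, by simp [hK]⟩
  simp only [Finset.mem_filter, Finset.mem_univ, true_and] at hX hmax
  refine ⟨X, hX.1, hX.2, h4.trans (Finset.card_le_card hX.1), fun v => ?_⟩
  by_contra! h
  have := hmax (insert v X) ⟨hX.1.trans (Finset.subset_insert _ _), by
    rw [Finset.coe_insert]
    exact hX.2.insert fun b hb _ => h b hb⟩
  rw [Finset.card_insert_of_notMem fun hv => (h v hv).ne rfl] at this
  omega

namespace IsMaxClique

theorem twin_self (hX : IsMaxClique G X) (hx : x ∈ X) : IsTwin G X x x :=
  ⟨hx, G.irrefl, fun _ hy hyx => hX.clique hx hy hyx.symm⟩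

theorem hasTwin (hX : IsMaxClique G X) (hG : Good G) (ha : a ∈ X) (hb : b ∈ X) (hab : a ≠ b)
    (va : G.Adj v a) (vb : G.Adj v b) : HasTwin G X v := by
  obtain ⟨x, hx, hvx⟩ := hX.exists_not_adj v
  refine ⟨x, hx, hvx, fun y hy hyx => ?_⟩
  by_contra hvy
  have hax : a ≠ x := by rintro rfl; exact hvx va
  have hbx : b ≠ x := by rintro rfl; exact hvx vb
  have hay : a ≠ y := by rintro rfl; exact hvy va
  have hby : b ≠ y := by rintro rfl; exact hvy vb
  exact hG.hvn a b x y v (hX.clique ha hb hab) (hX.clique ha hx hax) (hX.clique ha hy hay)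
    (hX.clique hb hx hbx) (hX.clique hb hy hby) (hX.clique hx hy hyx.symm) va vb hvx hvy

theorem eq_of_adj (hX : IsMaxClique G X) (hG : Good G) (hv : ¬HasTwin G X v) (ha : a ∈ X)
    (hb : b ∈ X) (va : G.Adj v a) (vb : G.Adj v b) : a = b :=
  by_contra fun hab => hv (hX.hasTwin hG ha hb hab va vb)

theorem not_adj_of_twin (hX : IsMaxClique G X) (hG : Good G) (hu : IsTwin G X x u)
    (hv : IsTwin G X x v) : ¬G.Adj u v := by
  intro huv
  obtain ⟨a, ha, b, hb, hab, hax, -, hbx, -⟩ := Finset.exists_pair_mem_ne hX.four_le x x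
  exact hG.hvn a b u v x (hX.clique ha hb hab) (hu.2.2 a ha hax).symm (hv.2.2 a ha hax).symm
    (hu.2.2 b hb hbx).symm (hv.2.2 b hb hbx).symm huv (hX.clique hu.1 ha hax.symm)
    (hX.clique hu.1 hb hbx.symm) (fun h => hu.2.1 h.symm) fun h => hv.2.1 h.symm

theorem adj_of_twin (hX : IsMaxClique G X) (hG : Good G) (hu : IsTwin G X x u)
    (hv : IsTwin G X y v) (hxy : x ≠ y) : G.Adj u v := by
  by_contra huv
  obtain ⟨a, ha, b, hb, hab, hax, hay, hbx, hby⟩ := Finset.exists_pair_mem_ne hX.four_le x y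
  exact hG.hvn a b u y v (hX.clique ha hb hab) (hu.2.2 a ha hax).symm (hX.clique ha hv.1 hay)
    (hu.2.2 b hb hbx).symm (hX.clique hb hv.1 hby) (hu.2.2 y hv.1 hxy.symm) (hv.2.2 a ha hay)
    (hv.2.2 b hb hby) (fun h => huv h.symm) hv.2.1

theorem touch_self (hX : IsMaxClique G X) (hx : x ∈ X) (hv : G.Adj v x) : Touch G X x v :=
  ⟨x, hX.twin_self hx, hv⟩

theorem touch_unique (hX : IsMaxClique G X) (hG : Good G) (hv : ¬HasTwin G X v)
    (h1 : Touch G X a v) (h2 : Touch G X b v) : a = b := by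
  by_contra hab
  obtain ⟨a', ha', va'⟩ := h1
  obtain ⟨b', hb', vb'⟩ := h2
  obtain ⟨c, hc, d, hd, hcd, hca, hcb, hda, hdb⟩ := Finset.exists_pair_mem_ne hX.four_le a b
  have main : ∀ c ∈ X, ∀ d ∈ X, c ≠ d → c ≠ a → c ≠ b → d ≠ a → d ≠ b → G.Adj v c → False := by
    intro c hc d hd hcd hca hcb hda hdb vc
    exact hG.hvn a' c b d v (ha'.2.2 c hc hca) (ha'.2.2 b hb'.1 (Ne.symm hab)) (ha'.2.2 d hd hda)
      (hX.clique hc hb'.1 hcb) (hX.clique hc hd hcd) (hX.clique hb'.1 hd hdb.symm) va' vc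
      (fun h => hcb (hX.eq_of_adj hG hv hc hb'.1 vc h))
      fun h => hcd (hX.eq_of_adj hG hv hc hd vc h)
  by_cases vc : G.Adj v c
  · exact main c hc d hd hcd hca hcb hda hdb vc
  by_cases vd : G.Adj v d
  · exact main d hd c hc hcd.symm hda hdb hca hcb vd
  exact hG.hvn a' b' c d v (hX.adj_of_twin hG ha' hb' hab) (ha'.2.2 c hc hca) (ha'.2.2 d hd hda)
    (hb'.2.2 c hc hcb) (hb'.2.2 d hd hdb) (hX.clique hc hd hcd) va' vb' vc vd

end IsMaxClique

theorem IsTwin.unique (h1 : IsTwin G X x v) (h2 : IsTwin G X y v) : x = y :=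
  by_contra fun h => h1.2.1 (h2.2.2 x h1.1 h)

end Parts

section Cases

variable {V : Type*} {G : SimpleGraph V} {X : Finset V}

theorem Good.colorable_ten [Fintype V] (hG : Good G) (h4 : G.CliqueFree 4) {a b c : V}
    (hab : G.Adj a b) (hac : G.Adj a c) (hbc : G.Adj b c) : G.Colorable 10 := by
  classical
  have stable : ∀ {u v}, G.Adj u v → ∀ w z, G.Adj w u → G.Adj w v → G.Adj z u → G.Adj z v →
      ¬G.Adj w z := fun {u v} huv w z wu wv zu zv wz =>
    h4 _
      ((is3Clique_triple_iff.2 ⟨zu, zv, huv⟩).insert (a := w) (by simp [wz, wu, wv]))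
  have hc3 : ∀ K : Finset V, G.IsClique (K : Set V) → K.card ≤ 3 := fun K hK => by
    by_contra! hc
    exact (h4.mono (by omega)) K ⟨hK, rfl⟩
  have hc2 : ∀ u, ∀ K : Finset V, (∀ w ∈ K, G.Adj w u) → G.IsClique (K : Set V) →
      K.card ≤ 2 := fun u K hKu hK => by
    have := hc3 (insert u K) (by
      rw [Finset.coe_insert]
      exact hK.insert fun w hw _ => (hKu w hw).symm)
    rw [Finset.card_insert_of_notMem fun h => (hKu u h).ne rfl] at this
    omega
  have part : ∀ {u v}, G.Adj u v → ∀ (n : ℕ) (p : V → Prop), 0 < n →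
      (∀ w, p w → ¬G.Adj w u ∧ ¬G.Adj w v) →
      (∀ K : Finset V, (∀ w ∈ K, p w) → G.IsClique (K : Set V) → K.card ≤ n) →
      ∃ f : V → Fin n, ∀ w z, p w → p z → G.Adj w z → f w ≠ f z := by
    intro u v huv n p hn hp hK
    have : Nonempty (Fin n) := ⟨⟨0, hn⟩⟩
    obtain ⟨f, -, hf⟩ := hG.exists_coloring huv (Finset.univ : Finset (Fin n))
      (Finset.univ.filter p) (by simpa using fun w hw => (hp w hw).1)
      (by simpa using fun w hw => (hp w hw).2) fun K hKp hKc => by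
        simpa using hK K (fun w hw => by simpa using hKp hw) hKc
    exact ⟨f, fun w z hw hz => hf w (by simpa using hw) z (by simpa using hz)⟩
  have hcls : ∀ w, ∃ i : Fin 6, (i = 0 → G.Adj w a ∧ G.Adj w b) ∧
      (i = 1 → G.Adj w a ∧ G.Adj w c) ∧ (i = 2 → G.Adj w b ∧ G.Adj w c) ∧
      (i = 3 → ¬G.Adj w a ∧ ¬G.Adj w b) ∧ (i = 4 → (¬G.Adj w a ∧ ¬G.Adj w c) ∧ G.Adj w b) ∧
      (i = 5 → (¬G.Adj w b ∧ ¬G.Adj w c) ∧ G.Adj w a) := by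
    intro w
    by_cases wa : G.Adj w a <;> by_cases wb : G.Adj w b <;> by_cases wc : G.Adj w c
    · exact ⟨0, by simp [wa, wb]⟩
    · exact ⟨0, by simp [wa, wb]⟩
    · exact ⟨1, by simp [wa, wc]⟩
    · exact ⟨5, by simp [wa, wb, wc]⟩
    · exact ⟨2, by simp [wb, wc]⟩
    · exact ⟨4, by simp [wa, wb, wc]⟩
    · exact ⟨3, by simp [wa, wb]⟩
    · exact ⟨3, by simp [wa, wb]⟩
  choose cls h0 h1 h2 h3 h4 h5 using hcls
  have := colorable_of_classes (G := G) cls ![1, 1, 1, 3, 2, 2] fun i => ?_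
  · simpa [Fin.sum_univ_succ] using this
  fin_cases i
  · exact ⟨fun _ => (0 : Fin 1), fun w z hw hz hwz => (stable hab w z (h0 w hw).1 (h0 w hw).2
      (h0 z hz).1 (h0 z hz).2 hwz).elim⟩
  · exact ⟨fun _ => (0 : Fin 1), fun w z hw hz hwz => (stable hac w z (h1 w hw).1 (h1 w hw).2
      (h1 z hz).1 (h1 z hz).2 hwz).elim⟩
  · exact ⟨fun _ => (0 : Fin 1), fun w z hw hz hwz => (stable hbc w z (h2 w hw).1 (h2 w hw).2
      (h2 z hz).1 (h2 z hz).2 hwz).elim⟩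
  · exact part hab 3 _ (by simp) h3 fun K _ => hc3 K
  · exact part hac 2 _ (by simp) (fun w hw => (h4 w hw).1)
      fun K hK => hc2 b K fun w hw => (h4 w (hK w hw)).2
  · exact part hbc 2 _ (by simp) (fun w hw => (h5 w hw).1)
      fun K hK => hc2 a K fun w hw => (h5 w (hK w hw)).2

theorem IsMaxClique.colorable_of_rest [Fintype V] (hX : IsMaxClique G X) (hG : Good G) {n : ℕ}
    (hn : ∀ K : Finset V, G.IsClique (K : Set V) → K.card ≤ n)
    (hR : ∀ K : Finset V, (∀ v ∈ K, ¬HasTwin G X v) → G.IsClique (K : Set V) → K.card ≤ 3) :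
    G.Colorable (n + 2) := by
  classical
  have hXn := hn X hX.clique
  obtain ⟨z, -⟩ : X.Nonempty := Finset.card_pos.1 (by have := hX.four_le; omega)
  obtain ⟨a, ha, b, hb, hab, -⟩ := Finset.exists_pair_mem_ne hX.four_le z z
  obtain ⟨c, hc, d, hd, hcd, hca, hcb, hda, hdb⟩ := Finset.exists_pair_mem_ne hX.four_le a b
  have : Nonempty V := ⟨a⟩
  obtain ⟨ρ, hρ⟩ := exists_injOn_fin X hXn (by have := hX.four_le; omega)
  have hr' : ∀ v, HasTwin G X v → ∃ x, IsTwin G X x v := fun v h => h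
  choose! r hr using hr'
  have hX2 : ∀ x ∈ X, ∀ y ∈ X, x ≠ y → ρ x ≠ ρ y := fun x hx y hy h h' => h (hρ hx hy h')
  have color : ∀ (x y : V) (i : Fin 2) (p : V → Prop), x ∈ X → y ∈ X → x ≠ y →
      (∀ v, p v → ¬HasTwin G X v ∧ ¬Touch G X x v ∧ ¬Touch G X y v) →
      ∃ f : V → Fin n ⊕ Fin 2, (∀ v, p v → f v ∈ ({.inl (ρ x), .inl (ρ y), .inr i} : Finset _)) ∧
        ∀ v w, p v → p w → G.Adj v w → f v ≠ f w := by
    intro x y i p hx hy hxy hp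
    obtain ⟨f, hfL, hf⟩ := hG.exists_coloring (hX.clique hx hy hxy)
      ({.inl (ρ x), .inl (ρ y), .inr i} : Finset (Fin n ⊕ Fin 2)) (Finset.univ.filter p)
      (fun v hv h => (hp v (by simpa using hv)).2.1 (hX.touch_self hx h))
      (fun v hv h => (hp v (by simpa using hv)).2.2 (hX.touch_self hy h)) fun K hK hKc => by
        refine (hR K (fun v hv => (hp v (by simpa using hK hv)).1) hKc).trans ?_
        rw [Finset.card_insert_of_notMem, Finset.card_insert_of_notMem, Finset.card_singleton]
        · simp
        · simpa using hX2 x hx y hy hxy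
    exact ⟨f, fun v hv => hfL v (by simpa using hv),
      fun v w hv hw => hf v (by simpa using hv) w (by simpa using hw)⟩
  obtain ⟨f, hfL, hf⟩ := color a b 0
    (fun v => ¬HasTwin G X v ∧ ¬Touch G X a v ∧ ¬Touch G X b v) ha hb hab fun _ h => h
  obtain ⟨g, hgL, hg⟩ := color c d 1
    (fun v => ¬HasTwin G X v ∧ (Touch G X a v ∨ Touch G X b v)) hc hd hcd (by
      rintro v ⟨hv, h | h⟩
      · exact ⟨hv, fun h' => hca (hX.touch_unique hG hv h' h),
          fun h' => hda (hX.touch_unique hG hv h' h)⟩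
      · exact ⟨hv, fun h' => hcb (hX.touch_unique hG hv h' h),
          fun h' => hdb (hX.touch_unique hG hv h' h)⟩)
  have := colorable_of_split (G := G) (κ := Fin n ⊕ Fin 2) (HasTwin G X) (fun v => .inl (ρ (r v)))
    (fun v => if Touch G X a v ∨ Touch G X b v then g v else f v) ?_ ?_ ?_
  · simpa using this
  · intro u v hu hv huv h
    have := hρ (hr u hu).1 (hr v hv).1 (by simpa using h)
    exact hX.not_adj_of_twin hG (hr u hu) (this ▸ hr v hv) huv
  · intro u v hu hv huv
    have sep : ∀ u v, ¬HasTwin G X u → ¬HasTwin G X v → ¬(Touch G X a u ∨ Touch G X b u) →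
        (Touch G X a v ∨ Touch G X b v) → f u ≠ g v := by
      intro u v hu hv hu' hv' h
      rw [not_or] at hu'
      have h1 := hfL u ⟨hu, hu'⟩
      have h2 := hgL v ⟨hv, hv'⟩
      rw [h] at h1
      simp only [Finset.mem_insert, Finset.mem_singleton] at h1 h2
      have := hX2 a ha c hc hca.symm
      have := hX2 b hb c hc hcb.symm
      have := hX2 a ha d hd hda.symm
      have := hX2 b hb d hd hdb.symm
      rcases h1 with h1 | h1 | h1 <;> rcases h2 with h2 | h2 | h2 <;> rw [h1] at h2 <;> simp_all
    by_cases hu' : Touch G X a u ∨ Touch G X b u <;>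
      by_cases hv' : Touch G X a v ∨ Touch G X b v <;> simp only [hu', hv', if_true, if_false]
    · exact hg u v ⟨hu, hu'⟩ ⟨hv, hv'⟩ huv
    · exact (sep v u hv hu hv' hu').symm
    · exact sep u v hu hv hu' hv'
    · exact hf u v ⟨hu, not_or.1 hu'⟩ ⟨hv, not_or.1 hv'⟩ huv
  · intro u v hu hv huv
    have key : ∀ x ∈ X, Sum.inl (ρ (r u)) = (Sum.inl (ρ x) : Fin n ⊕ Fin 2) → Touch G X x v := by
      intro x hx h
      have := hρ (hr u hu).1 hx (by simpa using h)
      exact ⟨u, this ▸ hr u hu, huv.symm⟩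
    by_cases hv' : Touch G X a v ∨ Touch G X b v <;> simp only [hv', if_true, if_false] <;> intro h
    · have := hgL v ⟨hv, hv'⟩
      rw [← h] at this
      simp only [Finset.mem_insert, Finset.mem_singleton, reduceCtorEq, or_false] at this
      rcases this with h | h <;> rcases hv' with h' | h'
      · exact hca (hX.touch_unique hG hv (key c hc h) h')
      · exact hcb (hX.touch_unique hG hv (key c hc h) h')
      · exact hda (hX.touch_unique hG hv (key d hd h) h')
      · exact hdb (hX.touch_unique hG hv (key d hd h) h')
    · have := hfL v ⟨hv, not_or.1 hv'⟩
      rw [← h] at this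
      simp only [Finset.mem_insert, Finset.mem_singleton, reduceCtorEq, or_false] at this
      rcases this with h | h
      · exact hv' (Or.inl (key a ha h))
      · exact hv' (Or.inr (key b hb h))

end Cases

section Bouquet

variable {V : Type*} {G : SimpleGraph V} {X T : Finset V} {x y z u v w e d : V}

/-- Some vertex is complete to two mutually anticomplete triangles. -/
def HasTwoTriangles (G : SimpleGraph V) : Prop :=
  ∃ x, ∃ E D : Finset V, G.IsNClique 3 E ∧ G.IsNClique 3 D ∧ (∀ e ∈ E, G.Adj x e) ∧
    (∀ d ∈ D, G.Adj x d) ∧ ∀ e ∈ E, ∀ d ∈ D, ¬G.Adj e d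

/-- Two maximal cliques sharing the vertex `x` and otherwise anticomplete. -/
structure Bouquet (G : SimpleGraph V) (X T : Finset V) (x : V) : Prop where
  left : IsMaxClique G X
  right : IsMaxClique G T
  mem_left : x ∈ X
  mem_right : x ∈ T
  not_adj : ∀ e ∈ X, e ≠ x → ∀ d ∈ T, d ≠ x → ¬G.Adj e d

theorem IsMaxClique.not_hasTwin_of_not_adj (ha : u ∈ X) (hb : w ∈ X) (huw : u ≠ w)
    (hu : ¬G.Adj v u) (hw : ¬G.Adj v w) : ¬HasTwin G X v := by
  rintro ⟨x, hx⟩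
  have h1 : u = x := by_contra fun h => hu (hx.2.2 u ha h)
  have h2 : w = x := by_contra fun h => hw (hx.2.2 w hb h)
  exact huw (h1.trans h2.symm)

theorem HasTwoTriangles.exists_bouquet [Fintype V] (h : HasTwoTriangles G) (hG : Good G) :
    ∃ X T x, Bouquet G X T x := by
  classical
  obtain ⟨x, E, D, hE, hD, hxE, hxD, hED⟩ := h
  have hE' := hE.insert hxE
  have hD' := hD.insert hxD
  obtain ⟨X, hEX, hX⟩ := IsMaxClique.exists_superset hE'.isClique hE'.card_eq.ge
  obtain ⟨T, hDT, hT⟩ := IsMaxClique.exists_superset hD'.isClique hD'.card_eq.ge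
  obtain ⟨e₁, he₁, e₂, he₂, he⟩ := Finset.one_lt_card.1 (hE.card_eq ▸ by norm_num : 1 < E.card)
  obtain ⟨d₁, hd₁, d₂, hd₂, hd⟩ := Finset.one_lt_card.1 (hD.card_eq ▸ by norm_num : 1 < D.card)
  have hEX' : ∀ e ∈ E, e ∈ X := fun e he => hEX (Finset.mem_insert_of_mem he)
  have hDT' : ∀ d ∈ D, d ∈ T := fun d hd => hDT (Finset.mem_insert_of_mem hd)
  have hxX : x ∈ X := hEX (Finset.mem_insert_self _ _)
  have hxT : x ∈ T := hDT (Finset.mem_insert_self _ _)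
  have hXD : ∀ e ∈ X, e ≠ x → ∀ d ∈ D, ¬G.Adj e d := fun e heX hex d hdD hed =>
    IsMaxClique.not_hasTwin_of_not_adj (hEX' _ he₁) (hEX' _ he₂) he
      (fun h => hED _ he₁ _ hdD h.symm) (fun h => hED _ he₂ _ hdD h.symm)
      (hX.hasTwin hG heX hxX hex hed.symm (hxD d hdD).symm)
  refine ⟨X, T, x, hX, hT, hxX, hxT, fun e heX hex d hdT hdx hed => ?_⟩
  exact IsMaxClique.not_hasTwin_of_not_adj (hDT' _ hd₁) (hDT' _ hd₂) hd (hXD e heX hex _ hd₁)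
    (hXD e heX hex _ hd₂) (hT.hasTwin hG hdT hxT hdx hed (hX.clique heX hxX hex))

namespace Bouquet

theorem symm (h : Bouquet G X T x) : Bouquet G T X x :=
  ⟨h.right, h.left, h.mem_right, h.mem_left, fun e he hex d hd hdx hed =>
    h.not_adj d hd hdx e he hex hed.symm⟩

theorem not_hasTwin_left (h : Bouquet G X T x) (hd : d ∈ T) (hdx : d ≠ x) : ¬HasTwin G X d := by
  obtain ⟨a, ha, b, hb, hab, hax, -, hbx, -⟩ := Finset.exists_pair_mem_ne h.left.four_le x x
  exact IsMaxClique.not_hasTwin_of_not_adj ha hb hab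
    (fun h' => h.not_adj a ha hax d hd hdx h'.symm) fun h' => h.not_adj b hb hbx d hd hdx h'.symm

theorem not_hasTwin_right_of_twin (h : Bouquet G X T x) (hG : Good G) (hv : IsTwin G X e v)
    (he : e ≠ x) : ¬HasTwin G T v := by
  rintro ⟨d, hd⟩
  have hvx : G.Adj v x := hv.2.2 x h.mem_left he.symm
  obtain ⟨a, ha, hax, had, -⟩ := Finset.exists_mem_ne_ne_ne h.right.four_le x d d
  exact he (h.left.touch_unique hG (h.not_hasTwin_left ha hax) ⟨v, hv, (hd.2.2 a ha had).symm⟩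
    ⟨x, h.left.twin_self h.mem_left, h.right.clique ha h.mem_right hax⟩)

theorem not_adj_twin (h : Bouquet G X T x) (hG : Good G) (hv : IsTwin G X e v) (he : e ≠ x)
    (hw : IsTwin G T d w) (hd : d ≠ x) : ¬G.Adj v w := by
  intro hvw
  exact he (h.left.touch_unique hG (h.symm.not_hasTwin_right_of_twin hG hw hd) ⟨v, hv, hvw.symm⟩
    ⟨x, h.left.twin_self h.mem_left, hw.2.2 x h.mem_right hd.symm⟩)

theorem exists_adj_of_separated (h : Bouquet G X T x) (hG : Good G) (hyX : ¬HasTwin G X y)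
    (hzX : ¬HasTwin G X z) (hyT : ¬HasTwin G T y) (hzT : ¬HasTwin G T z) (hyz : G.Adj y z)
    (hu : IsTwin G X e u) (he : e ≠ x) (hyu : G.Adj y u) (hzu : ¬G.Adj z u) :
    T.card = 4 ∧ ∃ d ∈ T, ∃ d' ∈ T, d ≠ x ∧ d' ≠ x ∧ d ≠ d' ∧ G.Adj y d ∧ G.Adj z d' := by
  classical
  obtain ⟨m, hm, hmx, hme, hzm⟩ : ∃ m ∈ X, m ≠ x ∧ m ≠ e ∧ ¬G.Adj z m := by
    by_cases hz : ∃ q ∈ X, G.Adj z q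
    · obtain ⟨q, hq, hzq⟩ := hz
      obtain ⟨m, hm, hmx, hme, hmq⟩ := Finset.exists_mem_ne_ne_ne h.left.four_le x e q
      exact ⟨m, hm, hmx, hme, fun h' => hmq (h.left.eq_of_adj hG hzX hm hq h' hzq)⟩
    · push Not at hz
      obtain ⟨m, hm, hmx, hme, -⟩ := Finset.exists_mem_ne_ne_ne h.left.four_le x e e
      exact ⟨m, hm, hmx, hme, hz m hm⟩
  have hym : ¬G.Adj y m := fun h' =>
    hme (h.left.touch_unique hG hyX (h.left.touch_self hm h') ⟨u, hu, hyu⟩)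
  have hit : ∀ a ∈ T, ∀ b ∈ T, a ≠ x → b ≠ x → a ≠ b →
      (G.Adj y a ∨ G.Adj z a) ∨ (G.Adj y b ∨ G.Adj z b) := by
    intro a ha b hb hax hbx hab
    have hu' : ∀ a ∈ T, a ≠ x → ¬G.Adj u a := fun a ha hax =>
      h.not_adj_twin hG hu he (h.right.twin_self ha) hax
    have := hG.exists_adj_of_P4 hyz.symm hyu (hu.2.2 m hm hme) hzu hzm hym
      (h.right.clique ha hb hab)
    have := hu' a ha hax
    have := hu' b hb hbx
    have := h.not_adj m hm hmx a ha hax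
    have := h.not_adj m hm hmx b hb hbx
    tauto
  have huniq : ∀ v, ¬HasTwin G T v → ((T.erase x).filter (G.Adj v)).card ≤ 1 := fun v hv =>
    Finset.card_le_one.2 fun a ha b hb => by
      simp only [Finset.mem_filter, Finset.mem_erase] at ha hb
      exact h.right.eq_of_adj hG hv ha.1.2 hb.1.2 ha.2 hb.2
  have hrest : ((T.erase x).filter fun a => ¬(G.Adj y a ∨ G.Adj z a)).card ≤ 1 :=
    Finset.card_le_one.2 fun a ha b hb => by
      simp only [Finset.mem_filter, Finset.mem_erase] at ha hb
      by_contra hab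
      exact (hit a ha.1.2 b hb.1.2 ha.1.1 hb.1.1 hab).elim ha.2 hb.2
  have hsum := Finset.card_filter_add_card_filter_not (s := T.erase x)
    fun a => G.Adj y a ∨ G.Adj z a
  rw [Finset.filter_or, Finset.card_erase_of_mem h.mem_right] at hsum
  have h4 := h.right.four_le
  have hy1 := huniq y hyT
  have hz1 := huniq z hzT
  have hle := Finset.card_union_le ((T.erase x).filter (G.Adj y)) ((T.erase x).filter (G.Adj z))
  refine ⟨by omega, ?_⟩
  obtain ⟨d, hd⟩ := Finset.card_eq_one.1
    (show ((T.erase x).filter (G.Adj y)).card = 1 by omega)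
  obtain ⟨d', hd'⟩ := Finset.card_eq_one.1
    (show ((T.erase x).filter (G.Adj z)).card = 1 by omega)
  have hdm : d ∈ (T.erase x).filter (G.Adj y) := by simp [hd]
  have hdm' : d' ∈ (T.erase x).filter (G.Adj z) := by simp [hd']
  simp only [Finset.mem_filter, Finset.mem_erase] at hdm hdm'
  refine ⟨d, hdm.1.2, d', hdm'.1.2, hdm.1.1, hdm'.1.1, ?_, hdm.2, hdm'.2⟩
  rintro rfl
  rw [hd, hd', Finset.union_idempotent, Finset.card_singleton] at hsum
  omega

/-- The vertices that have neighbours in both petals, when both cliques have four vertices. -/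
def Mixed (G : SimpleGraph V) (X T : Finset V) (x v : V) : Prop :=
  X.card = 4 ∧ T.card = 4 ∧ (∃ e ∈ X, e ≠ x ∧ G.Adj v e) ∧ ∃ d ∈ T, d ≠ x ∧ G.Adj v d

/-- The twins of vertices other than the centre. -/
def Core (G : SimpleGraph V) (X T : Finset V) (x u : V) : Prop :=
  ∃ e, e ≠ x ∧ (IsTwin G X e u ∨ IsTwin G T e u)

theorem core_of_mem_left (h : Bouquet G X T x) (he : e ∈ X) (hex : e ≠ x) : Core G X T x e :=
  ⟨e, hex, Or.inl (h.left.twin_self he)⟩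

theorem core_of_mem_right (h : Bouquet G X T x) (he : e ∈ T) (hex : e ≠ x) : Core G X T x e :=
  ⟨e, hex, Or.inr (h.right.twin_self he)⟩

/-- The vertices without a twin in `X` or in `T`. -/
def Outer (G : SimpleGraph V) (X T : Finset V) (v : V) : Prop :=
  ¬(HasTwin G X v ∨ HasTwin G T v)

theorem exists_rows_ne (h : Bouquet G X T x) (hG : Good G) (hy : Outer G X T y)
    (hz : Outer G X T z) (hyz : G.Adj y z) (hu : Core G X T x u) (hyu : G.Adj y u)
    (hzu : ¬G.Adj z u) :
    X.card = 4 ∧ T.card = 4 ∧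
      (∃ e ∈ X, ∃ e' ∈ X, e ≠ x ∧ e' ≠ x ∧ e ≠ e' ∧ G.Adj y e ∧ G.Adj z e') ∧
      ∃ d ∈ T, ∃ d' ∈ T, d ≠ x ∧ d' ≠ x ∧ d ≠ d' ∧ G.Adj y d ∧ G.Adj z d' := by
  have main : ∀ {X T : Finset V} {e}, Bouquet G X T x → ¬HasTwin G X y → ¬HasTwin G X z →
      ¬HasTwin G T y → ¬HasTwin G T z → e ≠ x → IsTwin G X e u → X.card = 4 ∧ T.card = 4 ∧
      (∃ e ∈ X, ∃ e' ∈ X, e ≠ x ∧ e' ≠ x ∧ e ≠ e' ∧ G.Adj y e ∧ G.Adj z e') ∧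
      ∃ d ∈ T, ∃ d' ∈ T, d ≠ x ∧ d' ≠ x ∧ d ≠ d' ∧ G.Adj y d ∧ G.Adj z d' := by
    intro X T e h hyX hzX hyT hzT he hu
    have h1 := h.exists_adj_of_separated hG hyX hzX hyT hzT hyz hu he hyu hzu
    obtain ⟨hT, d, hd, d', hd', hdx, hdx', hdd, hyd, hzd⟩ := h1
    have h2 := h.symm.exists_adj_of_separated hG hyT hzT hyX hzX hyz (h.right.twin_self hd) hdx
      hyd fun h' => hdd (h.right.eq_of_adj hG hzT hd hd' h' hzd)
    exact ⟨h2.1, hT, h2.2, d, hd, d', hd', hdx, hdx', hdd, hyd, hzd⟩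
  obtain ⟨hyX, hyT⟩ := not_or.1 hy
  obtain ⟨hzX, hzT⟩ := not_or.1 hz
  obtain ⟨e, he, hu | hu⟩ := hu
  · exact main h hyX hzX hyT hzT he hu
  · obtain ⟨h1, h2, h3, h4⟩ := main h.symm hyT hzT hyX hzX he hu
    exact ⟨h2, h1, h4, h3⟩

theorem mixed_of_separated (h : Bouquet G X T x) (hG : Good G) (hy : Outer G X T y)
    (hz : Outer G X T z) (hyz : G.Adj y z) (hu : Core G X T x u) (hyu : G.Adj y u)
    (hzu : ¬G.Adj z u) : Mixed G X T x y ∧ Mixed G X T x z := by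
  obtain ⟨hX, hT, ⟨e, he, e', he', hex, hex', -, hye, hze⟩, d, hd, d', hd', hdx, hdx', -, hyd,
    hzd⟩ := h.exists_rows_ne hG hy hz hyz hu hyu hzu
  exact ⟨⟨hX, hT, ⟨e, he, hex, hye⟩, d, hd, hdx, hyd⟩,
    ⟨hX, hT, ⟨e', he', hex', hze⟩, d', hd', hdx', hzd⟩⟩

theorem mixed_of_adj (h : Bouquet G X T x) (hG : Good G) (hy : Outer G X T y)
    (hz : Outer G X T z) (hyz : G.Adj y z) (hm : Mixed G X T x y) : Mixed G X T x z := by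
  obtain ⟨hX, hT, ⟨e, he, hex, hye⟩, d, hd, hdx, hyd⟩ := hm
  by_cases hze : G.Adj z e
  · by_cases hzd : G.Adj z d
    · exact ⟨hX, hT, ⟨e, he, hex, hze⟩, d, hd, hdx, hzd⟩
    · exact (h.mixed_of_separated hG hy hz hyz (h.core_of_mem_right hd hdx) hyd hzd).2
  · exact (h.mixed_of_separated hG hy hz hyz (h.core_of_mem_left he hex) hye hze).2

/-- Among outer vertices, the neighbour in one petal determines the neighbour in the other. -/
theorem eq_right_of_eq_left (h : Bouquet G X T x) (hG : Good G) (hy : Outer G X T y)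
    (hz : Outer G X T z) {d' : V} (he : e ∈ X) (hd : d ∈ T) (hdx : d ≠ x)
    (hd' : d' ∈ T) (hdx' : d' ≠ x) (hye : G.Adj y e) (hze : G.Adj z e) (hyd : G.Adj y d)
    (hzd : G.Adj z d') : d = d' := by
  by_contra hdd
  obtain ⟨hyX, hyT⟩ := not_or.1 hy
  obtain ⟨hzX, hzT⟩ := not_or.1 hz
  have hzd' : ¬G.Adj z d := fun h' => hdd (h.right.eq_of_adj hG hzT hd hd' h' hzd)
  have hyd' : ¬G.Adj y d' := fun h' => hdd (h.right.eq_of_adj hG hyT hd hd' hyd h')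
  by_cases hyz : G.Adj y z
  · obtain ⟨-, -, ⟨a, ha, b, hb, -, -, hab, hya, hzb⟩, -⟩ :=
      h.exists_rows_ne hG hy hz hyz (h.core_of_mem_right hd hdx) hyd hzd'
    exact hab ((h.left.eq_of_adj hG hyX ha he hya hye).trans
      (h.left.eq_of_adj hG hzX hb he hzb hze).symm)
  · obtain ⟨a, ha, b, hb, hab, hax, hae, hbx, hbe⟩ :=
      Finset.exists_pair_mem_ne h.left.four_le x e
    have := hG.exists_adj_of_P4 hyd (h.right.clique hd hd' hdd) hzd.symm hyd' hyz
      (fun h' => hzd' h'.symm) (h.left.clique ha hb hab)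
    have key : ∀ a ∈ X, a ≠ x → a ≠ e →
        ¬(G.Adj y a ∨ G.Adj d a ∨ G.Adj d' a ∨ G.Adj z a) := by
      rintro a ha hax hae (h' | h' | h' | h')
      · exact hae (h.left.eq_of_adj hG hyX ha he h' hye)
      · exact h.not_adj a ha hax d hd hdx h'.symm
      · exact h.not_adj a ha hax d' hd' hdx' h'.symm
      · exact hae (h.left.eq_of_adj hG hzX ha he h' hze)
    exact this.elim (key a ha hax hae) (key b hb hbx hbe)

theorem outer_symm (hy : Outer G X T y) : Outer G T X y :=
  fun h => hy h.symm

end Bouquet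

end Bouquet

section Bouquet

variable {V : Type*} {G : SimpleGraph V} {X T : Finset V} {x y z u v w e d : V}

theorem exists_injOn_fin_extend {s₀ s : Finset V} (hs : s₀ ⊆ s) {n : ℕ} (hn : 0 < n)
    (hsn : s.card ≤ n) {f : V → Fin n} (hf : Set.InjOn f (s₀ : Set V)) :
    ∃ g : V → Fin n, Set.InjOn g (s : Set V) ∧ ∀ v ∈ s₀, g v = f v := by
  classical
  have : Nonempty (Fin n) := ⟨⟨0, hn⟩⟩
  obtain ⟨g, hg, hginj⟩ := Set.Finite.exists_injOn_of_encard_le (s := ((s \ s₀ : Finset V) : Set V))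
    (t := (((s₀.image f)ᶜ : Finset (Fin n)) : Set (Fin n))) (s \ s₀).finite_toSet (by
      rw [Set.encard_coe_eq_coe_finsetCard, Set.encard_coe_eq_coe_finsetCard, Finset.card_compl,
        Finset.card_image_of_injOn hf, Finset.card_sdiff_of_subset hs, Fintype.card_fin]
      exact_mod_cast Nat.sub_le_sub_right hsn _)
  have hg' : ∀ v ∈ s, v ∉ s₀ → ∀ w ∈ s₀, g v ≠ f w := by
    intro v hv hv₀ w hw hvw
    have := hg (show v ∈ ((s \ s₀ : Finset V) : Set V) by simp [hv, hv₀])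
    rw [Finset.coe_compl, Finset.coe_image] at this
    exact this ⟨w, hw, hvw.symm⟩
  refine ⟨fun v => if v ∈ s₀ then f v else g v, fun v hv w hw hvw => ?_, fun v hv => by simp [hv]⟩
  by_cases hv₀ : v ∈ s₀ <;> by_cases hw₀ : w ∈ s₀ <;>
    simp only [hv₀, hw₀, if_true, if_false] at hvw
  · exact hf hv₀ hw₀ hvw
  · exact (hg' w hw hw₀ v hv₀ hvw.symm).elim
  · exact (hg' v hv hv₀ w hw₀ hvw).elim
  · exact hginj (by simpa [hv₀] using hv) (by simpa [hw₀] using hw) hvw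

theorem Finset.exists_eq_of_card_eq_four (hX : X.card = 4) (hx : x ∈ X) (he : e ∈ X)
    (hex : e ≠ x) : ∃ p ∈ X, ∃ q ∈ X, p ≠ x ∧ q ≠ x ∧ p ≠ e ∧ q ≠ e ∧ p ≠ q ∧
      ∀ a ∈ X, a ≠ x → a = e ∨ a = p ∨ a = q := by
  classical
  obtain ⟨p, hp, q, hq, hpq, hpx, hpe, hqx, hqe⟩ := Finset.exists_pair_mem_ne hX.ge x e
  refine ⟨p, hp, q, hq, hpx, hqx, hpe, hqe, hpq, fun a ha hax => ?_⟩
  by_contra! h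
  have hsub : ({a, x, e, p, q} : Finset V) ⊆ X := by
    simp [Finset.insert_subset_iff, ha, hx, he, hp, hq]
  have := Finset.card_le_card hsub
  rw [Finset.card_insert_of_notMem (by simp [hax, h]), Finset.card_insert_of_notMem
    (by simp [hex.symm, hpx.symm, hqx.symm]), Finset.card_insert_of_notMem
    (by simp [hpe.symm, hqe.symm]), Finset.card_insert_of_notMem (by simp [hpq]),
    Finset.card_singleton] at this
  omega

namespace Bouquet

/-- Outer vertices with neighbours in both petals, seen from the left petal. -/
def Row (G : SimpleGraph V) (X T : Finset V) (x e v : V) : Prop :=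
  Outer G X T v ∧ G.Adj v e ∧ ∃ d ∈ T, d ≠ x ∧ G.Adj v d

theorem row_unique (h : Bouquet G X T x) (hG : Good G) {e' : V} (he : e ∈ X) (he' : e' ∈ X)
    (hv : Row G X T x e v) (hv' : G.Adj v e') : e' = e :=
  h.left.eq_of_adj hG (not_or.1 hv.1).1 he' he hv' hv.2.1

/-- If one row contains a triangle, the other rows are stable. -/
theorem not_adj_of_triangle (h : Bouquet G X T x) (hG : Good G) {r : V} (hr : r ∈ X)
    (he : e ∈ X) (hrx : r ≠ x) (hex : e ≠ x) (her : e ≠ r) {S : Finset V}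
    (hS : G.IsNClique 3 S) (hSr : ∀ s ∈ S, Row G X T x r s) (hv : Row G X T x e v)
    (hw : Row G X T x e w) : ¬G.Adj v w := by
  classical
  obtain ⟨a, b, c, hab, hac, hbc, rfl⟩ := is3Clique_iff.1 hS
  have ha := hSr a (by simp)
  have hb := hSr b (by simp)
  have hc := hSr c (by simp)
  obtain ⟨m, hm, hmx, hme, hmr⟩ := Finset.exists_mem_ne_ne_ne h.left.four_le x e r
  have complete : ∀ v, Row G X T x e v → G.Adj v a ∧ G.Adj v b ∧ G.Adj v c := by
    intro v hv
    obtain ⟨d, hd, hdx, hvd⟩ := hv.2.2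
    have miss : ∀ s, Row G X T x r s → ¬G.Adj m s ∧ ¬G.Adj e s ∧ ¬G.Adj d s := fun s hs =>
      ⟨fun h' => hmr (h.row_unique hG hr hm hs h'.symm),
        fun h' => her (h.row_unique hG hr he hs h'.symm), fun h' => her
          (h.symm.eq_right_of_eq_left hG (outer_symm hv.1) (outer_symm hs.1) hd he hex hr hrx
            hvd h'.symm hv.2.1 hs.2.1)⟩
    have hit : ∀ s t, Row G X T x r s → Row G X T x r t → G.Adj s t →
        G.Adj v s ∨ G.Adj v t := by
      intro s t hs ht hst
      have := hG.exists_adj_of_P4 (h.left.clique hm he hme) hv.2.1.symm hvd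
        (fun h' => hme (h.row_unique hG he hm hv h'.symm)) (h.not_adj m hm hmx d hd hdx)
        (h.not_adj e he hex d hd hdx) hst
      have := miss s hs
      have := miss t ht
      tauto
    have hvr : ¬G.Adj v r := fun h' => her (h.row_unique hG he hr hv h').symm
    have third : ∀ s t k, Row G X T x r s → Row G X T x r t → Row G X T x r k → G.Adj s t →
        G.Adj s k → G.Adj t k → G.Adj v s → G.Adj v t → G.Adj v k := fun s t k hs ht hk st sk tk
        vs vt => by_contra fun vk =>
      hG.hvn s t k r v st sk hs.2.1 tk ht.2.1 hk.2.1 vs vt vk hvr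
    have h1 := hit a b ha hb hab
    have h2 := hit a c ha hc hac
    have h3 := hit b c hb hc hbc
    have h4 := third a b c ha hb hc hab hac hbc
    have h5 := third a c b ha hc hb hac hab hbc.symm
    have h6 := third b c a hb hc ha hbc hab.symm hac.symm
    tauto
  intro hvw
  have hv' := complete v hv
  have hw' := complete w hw
  exact hG.hvn v w a b e hvw hv'.1 hv'.2.1 hw'.1 hw'.2.1 hab hv.2.1.symm hw.2.1.symm
    (fun h' => her (h.row_unique hG hr he ha h'.symm))
    fun h' => her (h.row_unique hG hr he hb h'.symm)

theorem exists_coloring_rows [Fintype V] {κ : Type*} [Nonempty κ] (h : Bouquet G X T x)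
    (hG : Good G) (L : V → Finset κ) (φ : V → κ) (hφ : ∀ e ∈ X, e ≠ x → φ e ∉ L e)
    (hL : ∀ e ∈ X, ∀ e' ∈ X, e ≠ x → e' ≠ x → e ≠ e' → Disjoint (L e) (L e'))
    (hK : ∀ e ∈ X, e ≠ x → ∀ K : Finset V, (∀ v ∈ K, Row G X T x e v) →
      G.IsClique (K : Set V) → K.card ≤ (L e).card) :
    ∃ f : V → κ, ∀ e ∈ X, e ≠ x → ∀ v, Row G X T x e v → f v ≠ φ e ∧
      ∀ e' ∈ X, e' ≠ x → ∀ w, Row G X T x e' w → G.Adj v w → f v ≠ f w := by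
  classical
  have hrow : ∀ e, ∃ f : V → κ, e ∈ X → e ≠ x → (∀ v, Row G X T x e v → f v ∈ L e) ∧
      ∀ v w, Row G X T x e v → Row G X T x e w → G.Adj v w → f v ≠ f w := by
    intro e
    by_cases he : e ∈ X ∧ e ≠ x
    · obtain ⟨a, ha, b, hb, hab, -, hae, -, hbe⟩ := Finset.exists_pair_mem_ne h.left.four_le e e
      obtain ⟨f, hfL, hf⟩ := hG.exists_coloring (h.left.clique ha hb hab) (L e)
        (Finset.univ.filter (Row G X T x e))
        (fun v hv h' => hae (h.row_unique hG he.1 ha (by simpa using hv) h'))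
        (fun v hv h' => hbe (h.row_unique hG he.1 hb (by simpa using hv) h'))
        fun K hKe => hK e he.1 he.2 K fun v hv => by simpa using hKe hv
      exact ⟨f, fun _ _ => ⟨fun v hv => hfL v (by simpa using hv), fun v w hv hw =>
        hf v (by simpa using hv) w (by simpa using hw)⟩⟩
    · exact ⟨fun _ => Classical.arbitrary κ, fun h1 h2 => (he ⟨h1, h2⟩).elim⟩
  choose F hF using hrow
  have hrow' : ∀ v, (∃ e ∈ X, e ≠ x ∧ Row G X T x e v) → ∃ e ∈ X, e ≠ x ∧ Row G X T x e v :=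
    fun _ h' => h'
  have : Nonempty V := ⟨x⟩
  choose! row hrX hrx hrow' using hrow'
  have hroweq : ∀ e ∈ X, e ≠ x → ∀ v, Row G X T x e v → row v = e := fun e he hex v hv =>
    h.row_unique hG he (hrX v ⟨e, he, hex, hv⟩) hv (hrow' v ⟨e, he, hex, hv⟩).2.1
  refine ⟨fun v => F (row v) v, fun e he hex v hv => ⟨fun hfv => ?_,
    fun e' he' hex' w hw hvw => ?_⟩⟩
  · dsimp only at hfv
    rw [hroweq e he hex v hv] at hfv
    exact hφ e he hex (hfv ▸ (hF e he hex).1 v hv)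
  · dsimp only
    rw [hroweq e he hex v hv, hroweq e' he' hex' w hw]
    by_cases hee : e = e'
    · subst hee
      exact (hF e he hex).2 v w hv hw hvw
    · exact fun h' => Finset.disjoint_left.1 (hL e he e' he' hex hex' hee)
        ((hF e he hex).1 v hv) (h' ▸ (hF e' he' hex').1 w hw)

theorem exists_coloring_mixed [Fintype V] (h : Bouquet G X T x) (hG : Good G) {n : ℕ}
    (hn : ∀ K : Finset V, G.IsClique (K : Set V) → K.card ≤ n + 1) (hX : X.card = 4)
    {ρ : V → Fin n} (hρ : Set.InjOn ρ {e | e ∈ X ∧ e ≠ x}) :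
    ∃ f : V → Fin n ⊕ Fin 3, ∀ e ∈ X, e ≠ x → ∀ v, Row G X T x e v → f v ≠ .inl (ρ e) ∧
      ∀ e' ∈ X, e' ≠ x → ∀ w, Row G X T x e' w → G.Adj v w → f v ≠ f w := by
  classical
  have hρ' : ∀ e ∈ X, ∀ e' ∈ X, e ≠ x → e' ≠ x → e ≠ e' → ρ e ≠ ρ e' :=
    fun e he e' he' hex hex' hee h' => hee (hρ ⟨he, hex⟩ ⟨he', hex'⟩ h')
  by_cases htri : ∃ r ∈ X, r ≠ x ∧ ∃ S, G.IsNClique 3 S ∧ ∀ s ∈ S, Row G X T x r s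
  · obtain ⟨r, hr, hrx, S, hS, hSr⟩ := htri
    obtain ⟨p, hp, q, hq, hpx, hqx, hpr, hqr, hpq, hall⟩ :=
      Finset.exists_eq_of_card_eq_four hX h.mem_left hr hrx
    refine h.exists_coloring_rows (κ := Fin n ⊕ Fin 3) hG
      (fun e => if e = r then {.inl (ρ r), .inr 0, .inr 1}ᶜ else
      if e = p then {.inr 0} else {.inr 1}) (fun e => .inl (ρ e)) ?_ ?_ ?_
    · intro e he hex
      rcases hall e he hex with rfl | rfl | rfl <;> simp [hpr, hqr, hpq.symm]
    · intro e he e' he' hex hex' hee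
      rcases hall e he hex with rfl | rfl | rfl <;>
        rcases hall e' he' hex' with rfl | rfl | rfl <;> simp_all [Ne.symm]
    · intro e he hex K hK hKc
      by_cases her : e = r
      · subst her
        have := hn (insert e K) (by
          rw [Finset.coe_insert]
          exact hKc.insert fun v hv _ => (hK v hv).2.1.symm)
        rw [Finset.card_insert_of_notMem fun h' => (hK e h').2.1.ne rfl] at this
        simp only [if_true]
        rw [Finset.card_compl, Finset.card_insert_of_notMem (by simp),
          Finset.card_insert_of_notMem (by simp), Finset.card_singleton]
        simp
        omega
      · have hK1 : K.card ≤ 1 := Finset.card_le_one.2 fun v hv w hw => by_contra fun hvw =>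
          h.not_adj_of_triangle hG hr he hrx hex her hS hSr (hK v hv) (hK w hw) (hKc hv hw hvw)
        simp only [her, if_false]
        split_ifs <;> simpa using hK1
  · push Not at htri
    obtain ⟨r, hr, hrx, -⟩ := Finset.exists_mem_ne_ne_ne h.left.four_le x x x
    obtain ⟨p, hp, q, hq, hpx, hqx, hpr, hqr, hpq, hall⟩ :=
      Finset.exists_eq_of_card_eq_four hX h.mem_left hr hrx
    have h1 := hρ' p hp q hq hpx hqx hpq
    have h2 := hρ' p hp r hr hpx hrx hpr
    have h3 := hρ' q hq r hr hqx hrx hqr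
    refine h.exists_coloring_rows (κ := Fin n ⊕ Fin 3) hG
      (fun e => if e = p then {.inr 0, .inl (ρ q)} else
      if e = q then {.inr 1, .inl (ρ r)} else {.inr 2, .inl (ρ p)}) (fun e => .inl (ρ e)) ?_ ?_ ?_
    · intro e he hex
      rcases hall e he hex with rfl | rfl | rfl <;>
        simp [hpr.symm, hqr.symm, hpq.symm, h1, h2.symm, h3]
    · intro e he e' he' hex hex' hee
      rcases hall e he hex with rfl | rfl | rfl <;>
        rcases hall e' he' hex' with rfl | rfl | rfl <;>
        simp_all [hpr.symm, hqr.symm, hpq.symm, h1.symm, h2.symm, h3.symm]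
    · intro e he hex K hK hKc
      have hK2 : K.card ≤ 2 := by
        by_contra! hc
        obtain ⟨S, hSK, hS⟩ := Finset.exists_subset_card_eq hc
        obtain ⟨s, hs, hs'⟩ := htri e he hex S ⟨hKc.subset (by simpa using hSK), hS⟩
        exact hs' (hK s (hSK hs))
      refine hK2.trans ?_
      split_ifs <;> rw [Finset.card_insert_of_notMem (by simp)] <;> simp

end Bouquet

end Bouquet

section Bouquet

variable {V : Type*} {G : SimpleGraph V} {X T : Finset V} {x v : V}

namespace Bouquet

/-- Injective colourings of the two petals, agreeing along outer vertices. -/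
theorem exists_petal_colorings (h : Bouquet G X T x) (hG : Good G) {n : ℕ}
    (hX : X.card ≤ n + 1) (hT : T.card ≤ n + 1) :
    ∃ ρ σ : V → Fin n, Set.InjOn ρ {e | e ∈ X ∧ e ≠ x} ∧ Set.InjOn σ {d | d ∈ T ∧ d ≠ x} ∧
      ∀ y, Outer G X T y → ∀ e ∈ X, e ≠ x → ∀ d ∈ T, d ≠ x → G.Adj y e → G.Adj y d →
        ρ e = σ d := by
  classical
  have hn : 0 < n := by have := h.left.four_le; omega
  have hset : ∀ Z : Finset V, ((Z.erase x : Finset V) : Set V) = {e | e ∈ Z ∧ e ≠ x} := by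
    intro Z; ext e; simp [and_comm]
  obtain ⟨ρ, hρ⟩ := exists_injOn_fin (X.erase x) (n := n)
    (by rw [Finset.card_erase_of_mem h.mem_left]; omega) hn
  rw [hset] at hρ
  have hm : ∀ d, (∃ e, e ∈ X ∧ e ≠ x ∧ ∃ y, Outer G X T y ∧ G.Adj y e ∧ G.Adj y d) →
    ∃ e, e ∈ X ∧ e ≠ x ∧ ∃ y, Outer G X T y ∧ G.Adj y e ∧ G.Adj y d := fun _ h' => h'
  have : Nonempty V := ⟨x⟩
  choose! m hmX hmx hm using hm
  obtain ⟨σ, hσ, hσρ⟩ := exists_injOn_fin_extend (s₀ := (T.erase x).filter fun d =>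
    ∃ e, e ∈ X ∧ e ≠ x ∧ ∃ y, Outer G X T y ∧ G.Adj y e ∧ G.Adj y d) (s := T.erase x)
    (Finset.filter_subset _ _) hn (by rw [Finset.card_erase_of_mem h.mem_right]; omega)
    (f := fun d => ρ (m d)) (by
      intro d hd d' hd' hdd
      simp only [Finset.coe_filter, Finset.mem_erase, Set.mem_ofPred_eq] at hd hd'
      have hmm := hρ ⟨hmX d hd.2, hmx d hd.2⟩ ⟨hmX d' hd'.2, hmx d' hd'.2⟩ hdd
      obtain ⟨y, hy, hye, hyd⟩ := hm d hd.2
      obtain ⟨z, hz, hze, hzd⟩ := hm d' hd'.2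
      exact h.eq_right_of_eq_left hG hy hz (hmX d hd.2) hd.1.2 hd.1.1 hd'.1.2 hd'.1.1 hye
        (hmm ▸ hze) hyd hzd)
  rw [hset] at hσ
  refine ⟨ρ, σ, hρ, hσ, fun y hy e he hex d hd hdx hye hyd => ?_⟩
  have hex' : ∃ e, e ∈ X ∧ e ≠ x ∧ ∃ y, Outer G X T y ∧ G.Adj y e ∧ G.Adj y d :=
    ⟨e, he, hex, y, hy, hye, hyd⟩
  rw [hσρ d (by simpa [hd, hdx] using hex')]
  obtain ⟨z, hz, hze, hzd⟩ := hm d hex'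
  rw [h.symm.eq_right_of_eq_left hG (outer_symm hy) (outer_symm hz) hd he hex (hmX d hex')
    (hmx d hex') hyd hzd hye hze]

theorem colorable [Fintype V] (h : Bouquet G X T x) (hG : Good G) {n : ℕ}
    (hn : ∀ K : Finset V, G.IsClique (K : Set V) → K.card ≤ n + 1) : G.Colorable (n + 3) := by
  classical
  obtain ⟨ρ, σ, hρ, hσ, hρσ⟩ :=
    h.exists_petal_colorings hG (hn X h.left.clique) (hn T h.right.clique)
  have : Nonempty V := ⟨x⟩
  have hr : ∀ v, HasTwin G X v → ∃ e, IsTwin G X e v := fun _ h' => h'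
  choose! r hr using hr
  have hs : ∀ v, HasTwin G T v → ∃ e, IsTwin G T e v := fun _ h' => h'
  choose! s hs using hs
  set γ : V → Fin n ⊕ Fin 3 := fun e => if e = x then .inr 0 else .inl (ρ e) with hγ
  set δ : V → Fin n ⊕ Fin 3 := fun d => if d = x then .inr 1 else .inl (σ d) with hδ
  set g : V → Fin n ⊕ Fin 3 := fun u => if HasTwin G X u then γ (r u) else δ (s u) with hg
  have hcol := exists_coloring_of_types (G := G) {v | Outer G X T v}
    (fun v => {u | Core G X T x u ∧ G.Adj v u}) (Mixed G X T x)
    (fun v => Finset.univ.filter fun c => ∀ u, HasTwin G X u ∨ HasTwin G T u → G.Adj v u →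
      g u ≠ c) (fun v hv w hw hvw => h.mixed_of_adj hG hv hw hvw) ?_ ?_ ?_
  · obtain ⟨f, hf⟩ := hcol
    have := colorable_of_split (G := G) (fun v => HasTwin G X v ∨ HasTwin G T v) g f ?_
      (fun u v hu hv huv => (hf u hu).2 v hv huv) (fun u v hu hv huv => by
        have := (hf v hv).1
        rw [Finset.mem_filter] at this
        exact this.2 u hu huv.symm)
    · simpa using this
    · intro u v hu hv huv hguv
      have mixed : ∀ u v, HasTwin G X u → HasTwin G T v → γ (r u) = δ (s v) → ¬G.Adj u v := by
        intro u v hu hv huv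
        by_cases hrx : r u = x <;> by_cases hsx : s v = x <;> simp [hγ, hδ, hrx, hsx] at huv
        exact h.not_adj_twin hG (hr u hu) hrx (hs v hv) hsx
      by_cases huX : HasTwin G X u <;> by_cases hvX : HasTwin G X v <;>
        simp only [hg, huX, hvX, if_true, if_false] at hguv
      · have : r u = r v := by
          by_cases hru : r u = x <;> by_cases hrv : r v = x <;> simp [hγ, hru, hrv] at hguv
          · rw [hru, hrv]
          · exact hρ ⟨(hr u huX).1, hru⟩ ⟨(hr v hvX).1, hrv⟩ hguv
        exact h.left.not_adj_of_twin hG (hr u huX) (this ▸ hr v hvX) huv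
      · exact mixed u v huX (hv.resolve_left hvX) hguv huv
      · exact mixed v u hvX (hu.resolve_left huX) hguv.symm huv.symm
      · have huT := hu.resolve_left huX
        have hvT := hv.resolve_left hvX
        have : s u = s v := by
          by_cases hru : s u = x <;> by_cases hrv : s v = x <;> simp [hδ, hru, hrv] at hguv
          · rw [hru, hrv]
          · exact hσ ⟨(hs u huT).1, hru⟩ ⟨(hs v hvT).1, hrv⟩ hguv
        exact h.right.not_adj_of_twin hG (hs u huT) (this ▸ hs v hvT) huv
  · intro v hv w hw hvw hm
    ext u
    refine ⟨fun ⟨hu, hvu⟩ => ⟨hu, ?_⟩, fun ⟨hu, hwu⟩ => ⟨hu, ?_⟩⟩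
    · exact by_contra fun hwu => hm (h.mixed_of_separated hG hv hw hvw hu hvu hwu).1
    · exact by_contra fun hvu => hm (h.mixed_of_separated hG hw hv hvw.symm hu hwu hvu).2
  · by_cases hX : X.card = 4
    · obtain ⟨f, hf⟩ := h.exists_coloring_mixed hG hn hX hρ
      refine ⟨f, fun v hv ⟨_, _, ⟨e, he, hex, hve⟩, hd⟩ => ?_⟩
      have hfv := hf e he hex v ⟨hv, hve, hd⟩
      obtain ⟨d, hd, hdx, hvd⟩ := hd
      refine ⟨?_, fun w hw ⟨_, _, ⟨e', he', hex', hwe'⟩, hd'⟩ =>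
        hfv.2 e' he' hex' w ⟨hw, hwe', hd'⟩⟩
      rw [Finset.mem_filter]
      refine ⟨Finset.mem_univ _, fun u hu hvu hgu => hfv.1 (hgu.symm.trans ?_)⟩
      by_cases huX : HasTwin G X u <;> simp only [hg, huX, if_true, if_false]
      · rw [h.left.touch_unique hG (not_or.1 hv).1 ⟨u, hr u huX, hvu⟩ (h.left.touch_self he hve)]
        simp [hγ, hex]
      · rw [h.right.touch_unique hG (not_or.1 hv).2 ⟨u, hs u (hu.resolve_left huX), hvu⟩
          (h.right.touch_self hd hvd), hρσ v hv e he hex d hd hdx hve hvd]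
        simp [hδ, hdx]
    · exact ⟨fun _ => .inr 0, fun v _ hm => (hX hm.1).elim⟩
  · intro t
    have forced : ∀ {Z : Finset V}, IsMaxClique G Z → ∀ (γ : V → Fin n ⊕ Fin 3) (r : V → V),
        (∀ u, HasTwin G Z u → IsTwin G Z (r u) u) → (∀ v, Outer G X T v → ¬HasTwin G Z v) →
        (∀ e u, e ≠ x → IsTwin G Z e u → Core G X T x u) →
        ∃ c, ∀ v, Outer G X T v → {u | Core G X T x u ∧ G.Adj v u} = t → ∀ u, HasTwin G Z u →
          G.Adj v u → γ (r u) = c := by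
      intro Z hZ γ r hr hout hcore
      by_cases hex : ∃ e u, e ≠ x ∧ IsTwin G Z e u ∧ u ∈ t
      · obtain ⟨e, u, -, heu, hut⟩ := hex
        refine ⟨γ e, fun v hv hvt u' hu' hvu' => ?_⟩
        rw [← hvt] at hut
        rw [hZ.touch_unique hG (hout v hv) ⟨u', hr u' hu', hvu'⟩ ⟨u, heu, hut.2⟩]
      · refine ⟨γ x, fun v hv hvt u' hu' hvu' => ?_⟩
        by_contra hne
        have hrx : r u' ≠ x := fun h' => hne (by rw [h'])
        refine hex ⟨r u', u', hrx, hr u' hu', ?_⟩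
        rw [← hvt]
        exact ⟨hcore _ _ hrx (hr u' hu'), hvu'⟩
    obtain ⟨c, hc⟩ := forced h.left γ r hr (fun v hv => (not_or.1 hv).1)
      fun e u he hu => ⟨e, he, Or.inl hu⟩
    obtain ⟨c', hc'⟩ := forced h.right δ s hs (fun v hv => (not_or.1 hv).2)
      fun e u he hu => ⟨e, he, Or.inr hu⟩
    by_cases hne : ∃ v, Outer G X T v ∧ {u | Core G X T x u ∧ G.Adj v u} = t
    · obtain ⟨v₀, hv₀, hvt₀⟩ := hne
      obtain ⟨a, ha, b, hb, hab, hax, hbx, hva, hvb⟩ : ∃ a ∈ X, ∃ b ∈ X, a ≠ b ∧ a ≠ x ∧ b ≠ x ∧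
          ¬G.Adj v₀ a ∧ ¬G.Adj v₀ b := by
        by_cases hq : ∃ q ∈ X, G.Adj v₀ q
        · obtain ⟨q, hqX, hq⟩ := hq
          obtain ⟨a, ha, b, hb, hab, hax, haq, hbx, hbq⟩ :=
            Finset.exists_pair_mem_ne h.left.four_le x q
          exact ⟨a, ha, b, hb, hab, hax, hbx,
            fun h' => haq (h.left.eq_of_adj hG (not_or.1 hv₀).1 ha hqX h' hq),
            fun h' => hbq (h.left.eq_of_adj hG (not_or.1 hv₀).1 hb hqX h' hq)⟩
        · push Not at hq
          obtain ⟨a, ha, b, hb, hab, hax, -, hbx, -⟩ :=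
            Finset.exists_pair_mem_ne h.left.four_le x x
          exact ⟨a, ha, b, hb, hab, hax, hbx, hq a ha, hq b hb⟩
      have avoid : ∀ a ∈ X, a ≠ x → ¬G.Adj v₀ a → ∀ v,
          {u | Core G X T x u ∧ G.Adj v u} = t → ¬G.Adj v a := by
        intro a ha hax hva v hvt hva'
        have : a ∈ {u | Core G X T x u ∧ G.Adj v₀ u} := by
          rw [hvt₀, ← hvt]
          exact ⟨h.core_of_mem_left ha hax, hva'⟩
        exact hva this.2
      obtain ⟨f, hfL, hf⟩ := hG.exists_coloring (h.left.clique ha hb hab)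
        ({c, c'}ᶜ : Finset (Fin n ⊕ Fin 3)) (Finset.univ.filter fun v => Outer G X T v ∧
          {u | Core G X T x u ∧ G.Adj v u} = t)
        (fun v hv => avoid a ha hax hva v (Finset.mem_filter.1 hv).2.2)
        (fun v hv => avoid b hb hbx hvb v (Finset.mem_filter.1 hv).2.2) (fun K _ hK => by
          have h1 := hn K hK
          have h2 := Finset.card_le_two (a := c) (b := c')
          rw [Finset.card_compl]
          simp only [Fintype.card_sum, Fintype.card_fin]
          omega)
      refine ⟨f, fun v hv hvt => ⟨?_, fun w hw hwt => hf v (by simp [hvt]; exact hv) w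
        (by simp [hwt]; exact hw)⟩⟩
      have hfv := hfL v (by simp [hvt]; exact hv)
      simp only [Finset.mem_compl, Finset.mem_insert, Finset.mem_singleton, not_or] at hfv
      rw [Finset.mem_filter]
      refine ⟨Finset.mem_univ _, fun u hu hvu hgu => ?_⟩
      by_cases huX : HasTwin G X u <;> simp only [hg, huX, if_true, if_false] at hgu
      · exact hfv.1 (hgu.symm.trans (hc v hv hvt u huX hvu))
      · exact hfv.2 (hgu.symm.trans (hc' v hv hvt u (hu.resolve_left huX) hvu))
    · exact ⟨fun _ => .inr 0, fun v hv hvt => (hne ⟨v, hv, hvt⟩).elim⟩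

end Bouquet

end Bouquet

section Facing

variable {V : Type*} {G : SimpleGraph V} {A B : Finset V} {x y z u v w m : V}

/-- The vertex `v` has at most one neighbour in `A`. -/
def Loose (G : SimpleGraph V) (A : Finset V) (v : V) : Prop :=
  ∀ a ∈ A, ∀ b ∈ A, G.Adj v a → G.Adj v b → a = b

/-- Two large cliques between which the edges form a matching. -/
structure Facing (G : SimpleGraph V) (A B : Finset V) : Prop where
  isClique_left : G.IsClique (A : Set V)
  isClique_right : G.IsClique (B : Set V)
  four_le_left : 4 ≤ A.card
  four_le_right : 4 ≤ B.card
  loose_left : ∀ a ∈ A, Loose G B a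
  loose_right : ∀ b ∈ B, Loose G A b

open scoped Classical in
theorem Loose.card_le_one (h : Loose G A v) : (A.filter (G.Adj v)).card ≤ 1 :=
  Finset.card_le_one.2 fun a ha b hb => by
    simp only [Finset.mem_filter] at ha hb
    exact h a ha.1 b hb.1 ha.2 hb.2

theorem Loose.exists_mem_ne (h : Loose G A v) (hA : 4 ≤ A.card) (x y : V) :
    ∃ m ∈ A, m ≠ x ∧ m ≠ y ∧ ¬G.Adj v m := by
  by_cases hq : ∃ q ∈ A, G.Adj v q
  · obtain ⟨q, hqA, hq⟩ := hq
    obtain ⟨m, hm, hmx, hmy, hmq⟩ := Finset.exists_mem_ne_ne_ne hA x y q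
    exact ⟨m, hm, hmx, hmy, fun h' => hmq (h m hm q hqA h' hq)⟩
  · push Not at hq
    obtain ⟨m, hm, hmx, hmy, -⟩ := Finset.exists_mem_ne_ne_ne hA x y y
    exact ⟨m, hm, hmx, hmy, hq m hm⟩

open scoped Classical in
/-- Two loose sets of at most one vertex whose union has two vertices. -/
theorem Loose.exists_ne_of_two_le (hy : Loose G A y) (hz : Loose G A z)
    (h : 2 ≤ (A.filter (G.Adj y) ∪ A.filter (G.Adj z)).card) :
    ∃ a ∈ A, ∃ b ∈ A, a ≠ b ∧ G.Adj y a ∧ G.Adj z b := by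
  have h1 := hy.card_le_one
  have h2 := hz.card_le_one
  have h3 := Finset.card_union_le (A.filter (G.Adj y)) (A.filter (G.Adj z))
  obtain ⟨a, ha⟩ := Finset.card_eq_one.1 (show (A.filter (G.Adj y)).card = 1 by omega)
  obtain ⟨b, hb⟩ := Finset.card_eq_one.1 (show (A.filter (G.Adj z)).card = 1 by omega)
  have ha' : a ∈ A.filter (G.Adj y) := by simp [ha]
  have hb' : b ∈ A.filter (G.Adj z) := by simp [hb]
  simp only [Finset.mem_filter] at ha' hb'
  refine ⟨a, ha'.1, b, hb'.1, ?_, ha'.2, hb'.2⟩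
  rintro rfl
  rw [ha, hb, Finset.union_idempotent, Finset.card_singleton] at h
  omega

namespace Facing

theorem symm (h : Facing G A B) : Facing G B A :=
  ⟨h.isClique_right, h.isClique_left, h.four_le_right, h.four_le_left, h.loose_right,
    h.loose_left⟩

open scoped Classical in
theorem card_le_of_separated (h : Facing G A B) (hG : Good G) (hy : Loose G A y) (hyz : G.Adj y z)
    (hx : x ∈ A) (hm : m ∈ A) (hmx : m ≠ x) (hyx : G.Adj y x) (hzx : ¬G.Adj z x)
    (hzm : ¬G.Adj z m) :
    B.card ≤ (B.filter (G.Adj y) ∪ B.filter (G.Adj z) ∪ B.filter (G.Adj x) ∪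
      B.filter (G.Adj m)).card + 1 := by
  set H := B.filter (G.Adj y) ∪ B.filter (G.Adj z) ∪ B.filter (G.Adj x) ∪ B.filter (G.Adj m) with hH
  have hHB : H ⊆ B := by
    simp only [hH, ← Finset.filter_or]
    exact Finset.filter_subset _ _
  have : (B \ H).card ≤ 1 := Finset.card_le_one.2 fun b hb c hc => by
    simp only [hH, Finset.mem_sdiff, Finset.mem_union, Finset.mem_filter, not_or, not_and] at hb hc
    by_contra hbc
    have := hG.exists_adj_of_P4 hyz.symm hyx (h.isClique_left hx hm hmx.symm) hzx hzm
      (fun h' => hmx (hy m hm x hx h' hyx)) (h.isClique_right hb.1 hc.1 hbc)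
    obtain ⟨hbB, ⟨⟨hyb, hzb⟩, hxb⟩, hmb⟩ := hb
    obtain ⟨hcB, ⟨⟨hyc, hzc⟩, hxc⟩, hmc⟩ := hc
    rcases this with (h' | h' | h' | h') | (h' | h' | h' | h')
    exacts [hzb hbB h', hyb hbB h', hxb hbB h', hmb hbB h', hzc hcB h', hyc hcB h', hxc hcB h',
      hmc hcB h']
  rw [Finset.card_sdiff_of_subset hHB] at this
  omega

open scoped Classical in
theorem card_bounds_of_separated (h : Facing G A B) (hG : Good G) (hyA : Loose G A y)
    (hzA : Loose G A z) (hyz : G.Adj y z) (hx : x ∈ A) (hyx : G.Adj y x) (hzx : ¬G.Adj z x)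
    (hB : (B.filter (G.Adj y) ∪ B.filter (G.Adj z)).card + 3 ≤ B.card) :
    A.card + (B.filter (G.Adj y) ∪ B.filter (G.Adj z)).card ≤ B.card ∧
      B.card ≤ (B.filter (G.Adj y) ∪ B.filter (G.Adj z)).card + 3 := by
  set H := B.filter (G.Adj y) ∪ B.filter (G.Adj z) with hH
  have split : ∀ P Q : Finset V, (H ∪ P ∪ Q).card ≤ H.card + (P \ H).card + (Q \ H).card := by
    intro P Q
    have h1 : H ∪ P ∪ Q = H ∪ P \ H ∪ Q \ H := by
      ext v; simp only [Finset.mem_union, Finset.mem_sdiff]; tauto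
    rw [h1]
    exact (Finset.card_union_le _ _).trans (Nat.add_le_add_right (Finset.card_union_le _ _) _)
  have small : ∀ a ∈ A, (B.filter (G.Adj a) \ H).card ≤ 1 := fun a ha =>
    (Finset.card_le_card Finset.sdiff_subset).trans (h.loose_left a ha).card_le_one
  have hxm : ∀ m ∈ A, m ≠ x → ¬G.Adj z m → (B.filter (G.Adj x) \ H).card = 1 ∧
      (B.filter (G.Adj m) \ H).card = 1 ∧ B.card ≤ H.card + 3 := by
    intro m hm hmx hzm
    have h1 := h.card_le_of_separated hG hyA hyz hx hm hmx hyx hzx hzm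
    have h2 := split (B.filter (G.Adj x)) (B.filter (G.Adj m))
    have h3 := small x hx
    have h4 := small m hm
    rw [← hH] at h1
    omega
  obtain ⟨m₀, hm₀, hm₀x, -, hzm₀⟩ := hzA.exists_mem_ne h.four_le_left x x
  have h₀ := hxm m₀ hm₀ hm₀x hzm₀
  refine ⟨?_, h₀.2.2⟩
  have hne : ∀ a ∈ A, ∃ b, b ∈ B.filter (G.Adj a) \ H := by
    intro a ha
    have : (B.filter (G.Adj a) \ H).card = 1 := by
      by_cases hax : a = x
      · exact hax ▸ h₀.1
      by_cases hza : G.Adj z a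
      · have hya : ¬G.Adj y a := fun h' => hax (hyA a ha x hx h' hyx)
        obtain ⟨m, hm, hma, -, hym⟩ := hyA.exists_mem_ne h.four_le_left a a
        have h1 := h.card_le_of_separated hG hzA hyz.symm ha hm hma hza hya hym
        have h2 := split (B.filter (G.Adj a)) (B.filter (G.Adj m))
        have h3 := small a ha
        have h4 := small m hm
        rw [Finset.union_comm (B.filter (G.Adj z)), ← hH] at h1
        omega
      · exact (hxm a ha hax hza).2.1
    exact Finset.card_pos.1 (by omega)
  choose! φ hφ using hne
  have := Finset.card_le_card_of_injOn (s := A) (t := B \ H) φ (fun a ha => by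
    have := hφ a ha
    simp only [Finset.mem_sdiff, Finset.mem_filter] at this
    simp [this.1.1, this.2]) fun a ha b hb hab => by
    have h1 := hφ a ha
    have h2 := hφ b hb
    rw [← hab] at h2
    simp only [Finset.mem_sdiff, Finset.mem_filter] at h1 h2
    exact h.loose_right _ h1.1.1 a ha b hb h1.1.2.symm h2.1.2.symm
  have hHB : H ⊆ B := by
    simp only [hH, ← Finset.filter_or]
    exact Finset.filter_subset _ _
  rw [Finset.card_sdiff_of_subset hHB] at this
  omega

open scoped Classical in
theorem card_eq_four_of_separated (h : Facing G A B) (hG : Good G) (hyA : Loose G A y)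
    (hzA : Loose G A z) (hyB : Loose G B y) (hzB : Loose G B z) (hyz : G.Adj y z) (hx : x ∈ A)
    (hyx : G.Adj y x) (hzx : ¬G.Adj z x) :
    B.card = 4 ∧ ∃ b ∈ B, ∃ b' ∈ B, b ≠ b' ∧ G.Adj y b ∧ G.Adj z b' := by
  have h1 := h.card_bounds_of_separated hG hyA hzA hyz hx hyx hzx
  have h2 := Finset.card_union_le (B.filter (G.Adj y)) (B.filter (G.Adj z))
  have h3 := hyB.card_le_one
  have h4 := hzB.card_le_one
  have h5 := h.four_le_left
  have h6 := h.four_le_right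
  by_cases hB : (B.filter (G.Adj y) ∪ B.filter (G.Adj z)).card + 3 ≤ B.card
  · have := h1 hB
    omega
  · exact ⟨by omega, hyB.exists_ne_of_two_le hzB (by omega)⟩

theorem rows_ne (h : Facing G A B) (hG : Good G) (hyA : Loose G A y)
    (hzA : Loose G A z) (hyB : Loose G B y) (hzB : Loose G B z) (hyz : G.Adj y z)
    (hsep : ∃ x, (x ∈ A ∨ x ∈ B) ∧ ¬(G.Adj y x ↔ G.Adj z x)) :
    A.card = 4 ∧ B.card = 4 ∧ (∃ a ∈ A, ∃ a' ∈ A, a ≠ a' ∧ G.Adj y a ∧ G.Adj z a') ∧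
      ∃ b ∈ B, ∃ b' ∈ B, b ≠ b' ∧ G.Adj y b ∧ G.Adj z b' := by
  have main : ∀ {A B : Finset V} {y z x}, Facing G A B → Loose G A y → Loose G A z →
      Loose G B y → Loose G B z → G.Adj y z → x ∈ A → G.Adj y x → ¬G.Adj z x →
      A.card = 4 ∧ B.card = 4 ∧ (∃ a ∈ A, ∃ a' ∈ A, a ≠ a' ∧ G.Adj y a ∧ G.Adj z a') ∧
        ∃ b ∈ B, ∃ b' ∈ B, b ≠ b' ∧ G.Adj y b ∧ G.Adj z b' := by
    intro A B y z x h hyA hzA hyB hzB hyz hx hyx hzx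
    obtain ⟨hB, b, hb, b', hb', hbb, hyb, hzb⟩ :=
      h.card_eq_four_of_separated hG hyA hzA hyB hzB hyz hx hyx hzx
    obtain ⟨hA, hrows⟩ := h.symm.card_eq_four_of_separated hG hyB hzB hyA hzA hyz hb hyb
      fun h' => hbb (hzB b hb b' hb' h' hzb)
    exact ⟨hA, hB, hrows, b, hb, b', hb', hbb, hyb, hzb⟩
  obtain ⟨x, hx, hyzx⟩ := hsep
  have flip : ∀ A : Finset V, (∃ a ∈ A, ∃ a' ∈ A, a ≠ a' ∧ G.Adj z a ∧ G.Adj y a') →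
      ∃ a ∈ A, ∃ a' ∈ A, a ≠ a' ∧ G.Adj y a ∧ G.Adj z a' :=
    fun A ⟨a, ha, b, hb, hab, hza, hyb⟩ => ⟨b, hb, a, ha, hab.symm, hyb, hza⟩
  by_cases hyx : G.Adj y x
  · have hzx : ¬G.Adj z x := fun h' => hyzx ⟨fun _ => h', fun _ => hyx⟩
    rcases hx with hx | hx
    · exact main h hyA hzA hyB hzB hyz hx hyx hzx
    · obtain ⟨h1, h2, h3, h4⟩ := main h.symm hyB hzB hyA hzA hyz hx hyx hzx
      exact ⟨h2, h1, h4, h3⟩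
  · have hzx : G.Adj z x := by tauto
    rcases hx with hx | hx
    · obtain ⟨h1, h2, h3, h4⟩ := main h hzA hyA hzB hyB hyz.symm hx hzx hyx
      exact ⟨h1, h2, flip A h3, flip B h4⟩
    · obtain ⟨h1, h2, h3, h4⟩ := main h.symm hzB hyB hzA hyA hyz.symm hx hzx hyx
      exact ⟨h2, h1, flip A h4, flip B h3⟩

/-- Separation propagates along edges. -/
theorem separated_of_separated (h : Facing G A B) (hG : Good G) (hwA : Loose G A w)
    (huA : Loose G A u) (hwB : Loose G B w) (huB : Loose G B u) (hwu : G.Adj w u) (hwz : G.Adj w z)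
    (hsep : ∃ x, (x ∈ A ∨ x ∈ B) ∧ ¬(G.Adj w x ↔ G.Adj u x)) :
    ∃ x, (x ∈ A ∨ x ∈ B) ∧ ¬(G.Adj w x ↔ G.Adj z x) := by
  classical
  by_contra! hno
  obtain ⟨hA4, hB4, ⟨p, hp, r, hr, hpr, hwp, hur⟩, q, hq, s, hs, hqs, hwq, hus⟩ :=
    h.rows_ne hG hwA huA hwB huB hwu hsep
  have bond : ∀ b ∈ A, ∀ c ∈ B, G.Adj b c → b ≠ p → c = q := by
    intro b hb c hc hbc hbp
    by_contra hcq
    obtain ⟨d, hd, hdc, hdq, -⟩ := Finset.exists_mem_ne_ne_ne h.four_le_right c q q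
    obtain ⟨a, ha, hab, hap, hda⟩ := (h.loose_right d hd).exists_mem_ne h.four_le_left b p
    have hP := hG.exists_adj_of_P4 (h.isClique_left ha hb hab) hbc (h.isClique_right hc hd hdc.symm)
      (fun h' => hab (h.loose_right c hc a ha b hb h'.symm hbc.symm)) (fun h' => hda h'.symm)
      (fun h' => hdc (h.loose_left b hb d hd c hc h' hbc)) hwz
    have hA' : ∀ a ∈ A, a ≠ p → ¬G.Adj a w ∧ ¬G.Adj a z := by
      intro a ha hap
      have : ¬G.Adj w a := fun h' => hap (hwA a ha p hp h' hwp)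
      exact ⟨fun h' => this h'.symm, fun h' => this ((hno a (Or.inl ha)).2 h'.symm)⟩
    have hB' : ∀ a ∈ B, a ≠ q → ¬G.Adj a w ∧ ¬G.Adj a z := by
      intro a ha haq
      have : ¬G.Adj w a := fun h' => haq (hwB a ha q hq h' hwq)
      exact ⟨fun h' => this h'.symm, fun h' => this ((hno a (Or.inr ha)).2 h'.symm)⟩
    have := hA' a ha hap
    have := hA' b hb hbp
    have := hB' c hc hcq
    have := hB' d hd hdq
    tauto
  obtain ⟨m, hm, hmr, hmp, hwm⟩ := hwA.exists_mem_ne h.four_le_left r p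
  have hwr : ¬G.Adj w r := fun h' => hpr (hwA p hp r hr hwp h')
  have h1 := h.card_le_of_separated hG huA hwu.symm hr hm hmr hur hwr hwm
  have h2 : B.filter (G.Adj u) ∪ B.filter (G.Adj w) ∪ B.filter (G.Adj r) ∪ B.filter (G.Adj m) ⊆
      {q, s} := by
    intro b hb
    simp only [Finset.mem_union, Finset.mem_filter] at hb
    simp only [Finset.mem_insert, Finset.mem_singleton]
    rcases hb with ((⟨hb, hub⟩ | ⟨hb, hwb⟩) | ⟨hb, hrb⟩) | ⟨hb, hmb⟩
    · exact Or.inr (huB b hb s hs hub hus)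
    · exact Or.inl (hwB b hb q hq hwb hwq)
    · exact Or.inl (bond r hr b hb hrb hpr.symm)
    · exact Or.inl (bond m hm b hb hmb hmp)
  have h3 := (Finset.card_le_card h2).trans Finset.card_le_two
  omega

end Facing

end Facing

section Palette

/-- Colour lists for the rows of two cliques, using `n + ⌈n / 3⌉` colours. -/
theorem exists_palette {n : ℕ} (hn : 4 ≤ n) :
    ∃ A B : Fin n → Finset (Fin (n + (n + 2) / 3)), (∀ i, (A i).Nonempty) ∧
      (∀ i, (B i).Nonempty) ∧ (∀ i, (A i).card ≤ 2) ∧ (∀ i, (B i).card ≤ 2) ∧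
      (∀ i j, i ≠ j → Disjoint (A i) (A j)) ∧ (∀ i j, i ≠ j → Disjoint (B i) (B j)) ∧
      (∀ i j, A i ≠ B j) ∧ ∀ i j : Fin n, (j : ℕ) < 4 → ∃ c ∈ A i, c ∉ B j := by
  obtain ⟨t, ht⟩ : ∃ t, t = (n + 2) / 3 := ⟨_, rfl⟩
  rw [← ht]
  obtain ⟨a, rfl⟩ : ∃ a, n = a + t := ⟨n - t, by omega⟩
  let A : ℕ → Finset ℕ := fun i =>
    if i < a then Finset.Ico i (i + 1) else Finset.Ico (a + 2 * (i - a)) (a + 2 * (i - a) + 2)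
  let B : ℕ → Finset ℕ := fun i =>
    if i < 2 * t then Finset.Ico (a + i) (a + i + 1)
    else Finset.Ico (2 * (i - 2 * t)) (2 * (i - 2 * t) + 2)
  have hA : ∀ i c, c ∈ A i ↔ (i < a ∧ c = i) ∨
      (a ≤ i ∧ a + 2 * (i - a) ≤ c ∧ c < a + 2 * (i - a) + 2) := by
    intro i c
    simp only [A]
    split_ifs <;> rw [Finset.mem_Ico] <;> omega
  have hB : ∀ i c, c ∈ B i ↔ (i < 2 * t ∧ c = a + i) ∨
      (2 * t ≤ i ∧ 2 * (i - 2 * t) ≤ c ∧ c < 2 * (i - 2 * t) + 2) := by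
    intro i c
    simp only [B]
    split_ifs <;> rw [Finset.mem_Ico] <;> omega
  refine ⟨fun i => (A i).attachFin (n := a + t + t) fun c hc => ?_,
    fun i => (B i).attachFin (n := a + t + t) fun c hc => ?_,
    fun i => ?_, fun i => ?_, fun i => ?_, fun i => ?_, fun i j hij => ?_, fun i j hij => ?_,
    fun i j hij => ?_, fun i j hj => ?_⟩
  · have := i.2
    rw [hA] at hc
    omega
  · have := i.2
    rw [hB] at hc
    omega
  · rw [← Finset.card_pos, Finset.card_attachFin, Finset.card_pos]
    by_cases h : (i : ℕ) < a
    · exact ⟨i, (hA _ _).2 (by omega)⟩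
    · exact ⟨a + 2 * (i - a), (hA _ _).2 (by omega)⟩
  · rw [← Finset.card_pos, Finset.card_attachFin, Finset.card_pos]
    by_cases h : (i : ℕ) < 2 * t
    · exact ⟨a + i, (hB _ _).2 (by omega)⟩
    · exact ⟨2 * (i - 2 * t), (hB _ _).2 (by omega)⟩
  · rw [Finset.card_attachFin]
    simp only [A]
    split_ifs <;> simp
  · rw [Finset.card_attachFin]
    simp only [B]
    split_ifs <;> simp
  · have := Fin.val_ne_of_ne hij
    refine Finset.disjoint_left.2 fun c hc hc' => ?_
    rw [Finset.mem_attachFin, hA] at hc hc'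
    omega
  · have := Fin.val_ne_of_ne hij
    refine Finset.disjoint_left.2 fun c hc hc' => ?_
    rw [Finset.mem_attachFin, hB] at hc hc'
    omega
  · have hi := i.2
    have hj := j.2
    have key : ∀ c, c < a + t + t → (c ∈ A i ↔ c ∈ B j) := fun c hc => by
      have := Finset.ext_iff.1 hij ⟨c, hc⟩
      rwa [Finset.mem_attachFin, Finset.mem_attachFin] at this
    simp only [hA, hB] at key
    by_cases h : (i : ℕ) < a
    · have h1 := key i (by omega)
      have h2 := key (i + 1) (by omega)
      have h3 := key (i - 1) (by omega)
      omega
    · have h1 := key (a + 2 * (i - a)) (by omega)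
      have h2 := key (a + 2 * (i - a) + 1) (by omega)
      omega
  · have hi := i.2
    by_cases h : (i : ℕ) < a
    · refine ⟨⟨i, by omega⟩, ?_, ?_⟩ <;>
        simp only [Finset.mem_attachFin, hA, hB, and_true] <;> omega
    · by_cases h' : a + (j : ℕ) = a + 2 * (i - a)
      · refine ⟨⟨a + 2 * (i - a) + 1, by omega⟩, ?_, ?_⟩ <;>
          simp only [Finset.mem_attachFin, hA, hB] <;> omega
      · refine ⟨⟨a + 2 * (i - a), by omega⟩, ?_, ?_⟩ <;>
          simp only [Finset.mem_attachFin, hA, hB] <;> omega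

theorem exists_injective_ne {n : ℕ} (hn : 2 ≤ n) :
    ∃ π : Fin n → Fin n, Function.Injective π ∧ ∀ i, π i ≠ i := by
  refine ⟨fun i => ⟨if (i : ℕ) + 1 < n then i + 1 else 0, by split_ifs <;> omega⟩,
    fun i j hij => ?_, fun i hi => ?_⟩
  · simp only [Fin.mk.injEq] at hij
    ext
    split_ifs at hij <;> omega
  · have := congrArg Fin.val hi
    simp only at this
    split_ifs at this <;> omega

end Palette

section CliquePair

variable {V : Type*} {G : SimpleGraph V} {X T Z W : Finset V} {x y z u v w : V}

open scoped Classical in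
theorem IsMaxClique.not_forall_adj (hX : IsMaxClique G X) (hG : Good G)
    (h2 : ¬HasTwoTriangles G) {S : Finset V} (hS : G.IsNClique 3 S)
    (hSX : ∀ s ∈ S, ¬HasTwin G X s) (hv : HasTwin G X v) : ¬∀ s ∈ S, G.Adj v s := by
  intro hvS
  obtain ⟨x, hx⟩ := hv
  obtain ⟨E, hE, hE3⟩ := Finset.exists_subset_card_eq (s := X.erase x) (n := 3) (by
    have := hX.four_le
    rw [Finset.card_erase_of_mem hx.1]
    omega)
  have hEX : ∀ e ∈ E, e ∈ X ∧ e ≠ x := fun e he => (Finset.mem_erase.1 (hE he)).symm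
  refine h2 ⟨v, E, S, ⟨hX.clique.subset fun e he => (hEX e he).1, hE3⟩, hS,
    fun e he => hx.2.2 e (hEX e he).1 (hEX e he).2, hvS, fun e he s hs hes => ?_⟩
  exact (hEX e he).2 (hX.touch_unique hG (hSX s hs) (hX.touch_self (hEX e he).1 hes.symm)
    ⟨v, hx, (hvS s hs).symm⟩)

theorem IsMaxClique.loose (hX : IsMaxClique G X) (hG : Good G) (hZ : G.IsClique (Z : Set V))
    (hZX : ∀ z ∈ Z, HasTwin G X z) (hv : ¬HasTwin G X v) : Loose G Z v := by
  intro a ha b hb hva hvb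
  by_contra hab
  obtain ⟨p, hp⟩ := hZX a ha
  obtain ⟨q, hq⟩ := hZX b hb
  obtain rfl := hX.touch_unique hG hv ⟨a, hp, hva⟩ ⟨b, hq, hvb⟩
  exact hX.not_adj_of_twin hG hp hq (hZ ha hb hab)

open scoped Classical in
theorem IsMaxClique.exists_clique_mem (hX : IsMaxClique G X) (hu : HasTwin G X u) :
    ∃ Z : Finset V, u ∈ Z ∧ Z.card = X.card ∧ G.IsClique (Z : Set V) ∧ ∀ z ∈ Z, HasTwin G X z := by
  obtain ⟨x, hx⟩ := hu
  have hu' : u ∉ X.erase x := fun h =>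
    (hx.2.2 u (Finset.mem_of_mem_erase h) (Finset.ne_of_mem_erase h)).ne rfl
  refine ⟨insert u (X.erase x), Finset.mem_insert_self _ _, ?_, ?_, fun z hz => ?_⟩
  · have := hX.four_le
    rw [Finset.card_insert_of_notMem hu', Finset.card_erase_of_mem hx.1]
    omega
  · rw [Finset.coe_insert]
    refine (hX.clique.subset fun z hz => Finset.mem_of_mem_erase hz).insert fun z hz _ => ?_
    exact hx.2.2 z (Finset.mem_of_mem_erase hz) (Finset.ne_of_mem_erase hz)
  · rcases Finset.mem_insert.1 hz with rfl | hz
    · exact ⟨x, hx⟩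
    · exact ⟨z, hX.twin_self (Finset.mem_of_mem_erase hz)⟩

/-- Two maximal cliques such that no vertex has a twin in both of them. -/
structure CliquePair (G : SimpleGraph V) (X T : Finset V) : Prop where
  left : IsMaxClique G X
  right : IsMaxClique G T
  disjoint : ∀ v, HasTwin G X v → ¬HasTwin G T v

open scoped Classical in
theorem IsMaxClique.exists_cliquePair [Fintype V] (hX : IsMaxClique G X) (hG : Good G)
    (h2 : ¬HasTwoTriangles G) {K : Finset V} (hK : G.IsClique (K : Set V)) (hK4 : 4 ≤ K.card)
    (hKX : ∀ v ∈ K, ¬HasTwin G X v) : ∃ T, CliquePair G X T := by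
  obtain ⟨T, hKT, hT⟩ := IsMaxClique.exists_superset hK hK4
  refine ⟨T, hX, hT, fun v hvX ⟨t, ht⟩ => ?_⟩
  obtain ⟨S, hS, hS3⟩ := Finset.exists_subset_card_eq (s := K.erase t) (n := 3) (by
    have := Finset.pred_card_le_card_erase (s := K) (a := t)
    omega)
  have hSK : ∀ s ∈ S, s ∈ K ∧ s ≠ t := fun s hs => (Finset.mem_erase.1 (hS hs)).symm
  exact hX.not_forall_adj hG h2 ⟨hK.subset fun s hs => (hSK s hs).1, hS3⟩
    (fun s hs => hKX s (hSK s hs).1) hvX fun s hs => ht.2.2 s (hKT (hSK s hs).1) (hSK s hs).2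

namespace CliquePair

open Bouquet (Outer)

theorem symm (h : CliquePair G X T) : CliquePair G T X :=
  ⟨h.right, h.left, fun v hT hX => h.disjoint v hX hT⟩

theorem facing (h : CliquePair G X T) (hG : Good G) (hZ : G.IsClique (Z : Set V))
    (hW : G.IsClique (W : Set V)) (hZX : ∀ z ∈ Z, HasTwin G X z) (hWT : ∀ w ∈ W, HasTwin G T w)
    (hZ4 : 4 ≤ Z.card) (hW4 : 4 ≤ W.card) : Facing G Z W :=
  ⟨hZ, hW, hZ4, hW4, fun a ha => h.right.loose hG hW hWT (h.disjoint a (hZX a ha)),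
    fun b hb => h.left.loose hG hZ hZX (h.symm.disjoint b (hWT b hb))⟩

theorem exists_facing (h : CliquePair G X T) (hG : Good G) (hu : HasTwin G X u ∨ HasTwin G T u) :
    ∃ Z W : Finset V, Facing G Z W ∧ Z.card = X.card ∧ W.card = T.card ∧
      (∀ z ∈ Z, HasTwin G X z) ∧ (∀ w ∈ W, HasTwin G T w) ∧ (u ∈ Z ∨ u ∈ W) := by
  have hself : ∀ {X : Finset V}, IsMaxClique G X → ∀ x ∈ X, HasTwin G X x :=
    fun hX x hx => ⟨x, hX.twin_self hx⟩
  have hX4 := h.left.four_le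
  have hT4 := h.right.four_le
  rcases hu with hu | hu
  · obtain ⟨Z, huZ, hc, hZ, hZX⟩ := h.left.exists_clique_mem hu
    exact ⟨Z, T, h.facing hG hZ h.right.clique hZX (hself h.right) (hc ▸ hX4) hT4, hc, rfl, hZX,
      hself h.right, Or.inl huZ⟩
  · obtain ⟨W, huW, hc, hW, hWT⟩ := h.right.exists_clique_mem hu
    exact ⟨X, W, h.facing hG h.left.clique hW (hself h.left) hWT hX4 (hc ▸ hT4), rfl, hc,
      hself h.left, hWT, Or.inr huW⟩

/-- The neighbours of `v` that have a twin in `X` or in `T`. -/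
def trace (G : SimpleGraph V) (X T : Finset V) (v : V) : Set V :=
  {u | (HasTwin G X u ∨ HasTwin G T u) ∧ G.Adj v u}

theorem exists_of_trace_ne (h : trace G X T y ≠ trace G X T z) :
    ∃ u, (HasTwin G X u ∨ HasTwin G T u) ∧ ¬(G.Adj y u ↔ G.Adj z u) := by
  by_contra! hc
  refine h (Set.ext fun u => ⟨fun hu => ⟨hu.1, (hc u hu.1).1 hu.2⟩,
    fun hu => ⟨hu.1, (hc u hu.1).2 hu.2⟩⟩)

theorem touch_ne_of_trace_ne (h : CliquePair G X T) (hG : Good G) (hy : Outer G X T y)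
    (hz : Outer G X T z) (hyz : G.Adj y z) (hne : trace G X T y ≠ trace G X T z) :
    X.card = 4 ∧ T.card = 4 ∧ (∃ a a', a ≠ a' ∧ Touch G X a y ∧ Touch G X a' z) ∧
      ∃ b b', b ≠ b' ∧ Touch G T b y ∧ Touch G T b' z := by
  obtain ⟨u, hu, hyzu⟩ := exists_of_trace_ne hne
  obtain ⟨Z, W, hF, hZ, hW, hZX, hWT, huZW⟩ := h.exists_facing hG hu
  rw [Outer, not_or] at hy hz
  obtain ⟨hZ4, hW4, ⟨a, ha, a', ha', haa, hya, hza⟩, b, hb, b', hb', hbb, hyb, hzb⟩ :=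
    hF.rows_ne hG (h.left.loose hG hF.isClique_left hZX hy.1)
      (h.left.loose hG hF.isClique_left hZX hz.1) (h.right.loose hG hF.isClique_right hWT hy.2)
      (h.right.loose hG hF.isClique_right hWT hz.2) hyz ⟨u, huZW, hyzu⟩
  refine ⟨hZ ▸ hZ4, hW ▸ hW4, ?_, ?_⟩
  · obtain ⟨p, hp⟩ := hZX a ha
    obtain ⟨p', hp'⟩ := hZX a' ha'
    refine ⟨p, p', ?_, ⟨a, hp, hya⟩, ⟨a', hp', hza⟩⟩
    rintro rfl
    exact h.left.not_adj_of_twin hG hp hp' (hF.isClique_left ha ha' haa)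
  · obtain ⟨p, hp⟩ := hWT b hb
    obtain ⟨p', hp'⟩ := hWT b' hb'
    refine ⟨p, p', ?_, ⟨b, hp, hyb⟩, ⟨b', hp', hzb⟩⟩
    rintro rfl
    exact h.right.not_adj_of_twin hG hp hp' (hF.isClique_right hb hb' hbb)

theorem trace_ne_of_trace_ne (h : CliquePair G X T) (hG : Good G) (hw : Outer G X T w)
    (hu : Outer G X T u) (hwu : G.Adj w u) (hwz : G.Adj w z)
    (hne : trace G X T w ≠ trace G X T u) : trace G X T w ≠ trace G X T z := by
  obtain ⟨v, hv, hwuv⟩ := exists_of_trace_ne hne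
  obtain ⟨Z, W, hF, -, -, hZX, hWT, hvZW⟩ := h.exists_facing hG hv
  rw [Outer, not_or] at hw hu
  obtain ⟨s, hs, hwzs⟩ := hF.separated_of_separated hG (h.left.loose hG hF.isClique_left hZX hw.1)
    (h.left.loose hG hF.isClique_left hZX hu.1) (h.right.loose hG hF.isClique_right hWT hw.2)
    (h.right.loose hG hF.isClique_right hWT hu.2) hwu hwz ⟨v, hvZW, hwuv⟩
  have hsB : HasTwin G X s ∨ HasTwin G T s := hs.imp (hZX s) (hWT s)
  intro heq
  have := Set.ext_iff.1 heq s
  exact hwzs ⟨fun h' => (this.1 ⟨hsB, h'⟩).2, fun h' => (this.2 ⟨hsB, h'⟩).2⟩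

theorem exists_twin_coloring (h : CliquePair G X T) (hG : Good G) {κ : Type*}
    (A B : V → Finset κ) (hA : ∀ x ∈ X, (A x).Nonempty) (hB : ∀ y ∈ T, (B y).Nonempty)
    (hAA : ∀ x ∈ X, ∀ y ∈ X, x ≠ y → Disjoint (A x) (A y))
    (hBB : ∀ x ∈ T, ∀ y ∈ T, x ≠ y → Disjoint (B x) (B y))
    (hAB : ∀ x ∈ X, ∀ y ∈ T, A x ≠ B y) :
    ∃ g : V → κ, (∀ x u, IsTwin G X x u → g u ∈ A x) ∧ (∀ y u, IsTwin G T y u → g u ∈ B y) ∧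
      ∀ u v, HasTwin G X u ∨ HasTwin G T u → HasTwin G X v ∨ HasTwin G T v → G.Adj u v →
        g u ≠ g v := by
  have pick : ∀ {X T : Finset V} {A B : V → Finset κ}, CliquePair G X T →
      (∀ x ∈ X, (A x).Nonempty) → ∀ x u, IsTwin G X x u → ∃ c ∈ A x, ∀ y, Touch G T y u →
        (∃ c ∈ A x, c ∉ B y) → c ∉ B y := by
    intro X T A B h hA x u hu
    by_cases hy : ∃ y, Touch G T y u ∧ ∃ c ∈ A x, c ∉ B y
    · obtain ⟨y, hy, c, hc, hcy⟩ := hy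
      refine ⟨c, hc, fun z hz _ => ?_⟩
      rwa [h.right.touch_unique hG (h.disjoint u ⟨x, hu⟩) hz hy]
    · obtain ⟨c, hc⟩ := hA x hu.1
      exact ⟨c, hc, fun y h1 h3 => (hy ⟨y, h1, h3⟩).elim⟩
  have hg : ∀ u, ∃ c, (HasTwin G X u ∨ HasTwin G T u) →
      (∀ x, IsTwin G X x u → c ∈ A x ∧ ∀ y, Touch G T y u → (∃ c ∈ A x, c ∉ B y) → c ∉ B y) ∧
      ∀ y, IsTwin G T y u → c ∈ B y ∧ ∀ x, Touch G X x u → (∃ c ∈ B y, c ∉ A x) → c ∉ A x := by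
    intro u
    by_cases huX : HasTwin G X u
    · obtain ⟨x, hx⟩ := huX
      obtain ⟨c, hc⟩ := pick (B := B) h hA x u hx
      refine ⟨c, fun _ => ⟨fun x' hx' => ?_, fun y hy => (h.disjoint u ⟨x, hx⟩ ⟨y, hy⟩).elim⟩⟩
      rwa [← hx.unique hx']
    · by_cases huT : HasTwin G T u
      · obtain ⟨y, hy⟩ := huT
        obtain ⟨c, hc⟩ := pick (B := A) h.symm hB y u hy
        refine ⟨c, fun _ => ⟨fun x hx => (huX ⟨x, hx⟩).elim, fun y' hy' => ?_⟩⟩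
        rwa [← hy.unique hy']
      · obtain ⟨x, hx⟩ := Finset.card_pos.1 (Nat.lt_of_lt_of_le (by norm_num) h.left.four_le)
        obtain ⟨c, -⟩ := hA x hx
        exact ⟨c, fun h' => (h'.elim huX huT).elim⟩
  choose g hg using hg
  have hgX : ∀ x u, IsTwin G X x u → g u ∈ A x := fun x u hx => ((hg u (Or.inl ⟨x, hx⟩)).1 x hx).1
  have hgT : ∀ y u, IsTwin G T y u → g u ∈ B y := fun y u hy => ((hg u (Or.inr ⟨y, hy⟩)).2 y hy).1
  have mixed : ∀ u v x y, IsTwin G X x u → IsTwin G T y v → G.Adj u v → g u ≠ g v := by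
    intro u v x y hu hv huv heq
    have h1 := ((hg u (Or.inl ⟨x, hu⟩)).1 x hu).2 y ⟨v, hv, huv⟩
    have h2 := ((hg v (Or.inr ⟨y, hv⟩)).2 y hv).2 x ⟨u, hu, huv.symm⟩
    refine hAB x hu.1 y hv.1 (Finset.ext fun c => ⟨fun hc => ?_, fun hc => ?_⟩)
    · exact by_contra fun hc' => h1 ⟨c, hc, hc'⟩ (heq ▸ hgT y v hv)
    · exact by_contra fun hc' => h2 ⟨c, hc, hc'⟩ (heq ▸ hgX x u hu)
  refine ⟨g, hgX, hgT, ?_⟩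
  rintro u v (⟨x, hx⟩ | ⟨x, hx⟩) (⟨y, hy⟩ | ⟨y, hy⟩) huv
  · have hxy : x ≠ y := by rintro rfl; exact h.left.not_adj_of_twin hG hx hy huv
    exact Finset.disjoint_iff_ne.1 (hAA x hx.1 y hy.1 hxy) _ (hgX x u hx) _ (hgX y v hy)
  · exact mixed u v x y hx hy huv
  · exact (mixed v u y x hy hx huv.symm).symm
  · have hxy : x ≠ y := by rintro rfl; exact h.right.not_adj_of_twin hG hx hy huv
    exact Finset.disjoint_iff_ne.1 (hBB x hx.1 y hy.1 hxy) _ (hgT x u hx) _ (hgT y v hy)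

open scoped Classical in
theorem colorable [Fintype V] (h : CliquePair G X T) (hG : Good G) (h2 : ¬HasTwoTriangles G)
    {n : ℕ} (hn : ∀ K : Finset V, G.IsClique (K : Set V) → K.card ≤ n) :
    G.Colorable (n + (n + 2) / 3) := by
  have hXn := hn X h.left.clique
  have hTn := hn T h.right.clique
  have hX4 := h.left.four_le
  have hT4 := h.right.four_le
  have hn4 : 4 ≤ n := hX4.trans hXn
  obtain ⟨A, B, hA, hB, hA2, hB2, hAA, hBB, hAB, hAB4⟩ := exists_palette hn4
  obtain ⟨π, hπ, hπne⟩ := exists_injective_ne (n := n) (by omega)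
  obtain ⟨ρ, hρ⟩ := exists_injOn_fin X hXn (by omega)
  obtain ⟨σ', hσ'⟩ := exists_injOn_fin T le_rfl (by omega)
  set σ : V → Fin n := fun v => (σ' v).castLE hTn with hσdef
  have hσ : Set.InjOn σ (T : Set V) := fun a ha b hb hab => hσ' ha hb (Fin.castLE_injective hTn hab)
  have hσT : ∀ v, (σ v : ℕ) < T.card := fun v => (σ' v).2
  obtain ⟨g, hgX, hgT, hg⟩ := h.exists_twin_coloring hG (fun v => A (ρ v)) (fun v => B (σ v))
    (fun _ _ => hA _) (fun _ _ => hB _) (fun x hx y hy hxy => hAA _ _ fun h' => hxy (hρ hx hy h'))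
    (fun x hx y hy hxy => hBB _ _ fun h' => hxy (hσ hx hy h')) fun _ _ _ _ => hAB _ _
  have hrowX : ∀ v x u, Outer G X T v → Touch G X x v → HasTwin G X u → G.Adj v u →
      g u ∈ A (ρ x) := by
    rintro v x u hv hx ⟨x', hx'⟩ hvu
    rw [h.left.touch_unique hG (not_or.1 hv).1 hx ⟨u, hx', hvu⟩]
    exact hgX x' u hx'
  have hrowT : ∀ v x u, Outer G X T v → Touch G T x v → HasTwin G T u → G.Adj v u →
      g u ∈ B (σ x) := by
    rintro v x u hv hx ⟨x', hx'⟩ hvu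
    rw [h.right.touch_unique hG (not_or.1 hv).2 hx ⟨u, hx', hvu⟩]
    exact hgT x' u hx'
  have hcol := exists_coloring_of_types (G := G) {v | Outer G X T v} (trace G X T)
    (fun v => ∃ w, Outer G X T w ∧ G.Adj v w ∧ trace G X T v ≠ trace G X T w)
    (fun v => Finset.univ.filter fun c => ∀ u ∈ trace G X T v, g u ≠ c)
    (fun v hv w hw hvw ⟨z, hz, hvz, hne⟩ =>
      ⟨v, hv, hvw.symm, (h.trace_ne_of_trace_ne hG hv hz hvz hvw hne).symm⟩)
    (fun v hv w hw hvw hP => by_contra fun hne => hP ⟨w, hw, hvw, hne⟩) ?_ ?_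
  · obtain ⟨f, hf⟩ := hcol
    have := colorable_of_split (G := G) (fun v => HasTwin G X v ∨ HasTwin G T v) g f hg
      (fun u v hu hv huv => (hf u hu).2 v hv huv) (fun u v hu hv huv => by
        have := (hf v hv).1
        rw [Finset.mem_filter] at this
        exact this.2 u ⟨hu, huv.symm⟩)
    simpa using this
  · have hP : ∀ v, Outer G X T v ∧
        (∃ w, Outer G X T w ∧ G.Adj v w ∧ trace G X T v ≠ trace G X T w) →
        ∃ x y, Touch G X x v ∧ Touch G T y v ∧ ∃ c ∈ A (π (ρ x)), c ∉ B (σ y) := by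
      rintro v ⟨hv, w, hw, hvw, hne⟩
      obtain ⟨-, hT, ⟨x, -, -, hx, -⟩, y, -, -, hy, -⟩ := h.touch_ne_of_trace_ne hG hv hw hvw hne
      exact ⟨x, y, hx, hy, hAB4 _ _ (hT ▸ hσT y)⟩
    have : Nonempty (Fin (n + (n + 2) / 3)) := ⟨⟨0, by omega⟩⟩
    by_cases hV : Nonempty V
    swap
    · exact ⟨g, fun v => (hV ⟨v⟩).elim⟩
    choose! x y hx hy c hcA hcB using hP
    refine ⟨c, fun v hv hPv => ⟨?_, fun w hw hPw hvw => ?_⟩⟩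
    · rw [Finset.mem_filter]
      refine ⟨Finset.mem_univ _, fun u ⟨hu, hvu⟩ hgu => ?_⟩
      rcases hu with hu | hu
      · exact Finset.disjoint_iff_ne.1 (hAA _ _ (hπne (ρ (x v)))) _ (hcA v ⟨hv, hPv⟩) _
          (hrowX v (x v) u hv (hx v ⟨hv, hPv⟩) hu hvu) hgu.symm
      · exact hcB v ⟨hv, hPv⟩ (hgu ▸ hrowT v (y v) u hv (hy v ⟨hv, hPv⟩) hu hvu)
    · obtain ⟨z, hz, hvz, hne⟩ := id hPv
      obtain ⟨-, -, ⟨p, q, hpq, hp, hq⟩, -⟩ := h.touch_ne_of_trace_ne hG hv hw hvw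
        (h.trace_ne_of_trace_ne hG hv hz hvz hvw hne)
      rw [h.left.touch_unique hG (not_or.1 hv).1 hp (hx v ⟨hv, hPv⟩),
        h.left.touch_unique hG (not_or.1 hw).1 hq (hx w ⟨hw, hPw⟩)] at hpq
      have hmem : ∀ v, Touch G X (x v) v → x v ∈ X := fun v ⟨u, hu, _⟩ => hu.1
      exact Finset.disjoint_iff_ne.1 (hAA _ _ fun h' =>
        hpq (hρ (hmem v (hx v ⟨hv, hPv⟩)) (hmem w (hx w ⟨hw, hPw⟩)) (hπ h'))) _ (hcA v ⟨hv, hPv⟩) _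
        (hcA w ⟨hw, hPw⟩)
  · intro t
    by_cases ht : ∃ v, Outer G X T v ∧ trace G X T v = t
    swap
    · exact ⟨g, fun v hv hvt => (ht ⟨v, hv, hvt⟩).elim⟩
    obtain ⟨v₀, hv₀, rfl⟩ := ht
    have hloose : Loose G X v₀ := h.left.loose hG h.left.clique
      (fun x hx => ⟨x, h.left.twin_self hx⟩) (not_or.1 hv₀).1
    obtain ⟨p, hp, -, -, hvp⟩ := hloose.exists_mem_ne hX4 v₀ v₀
    obtain ⟨q, hq, hqp, -, hvq⟩ := hloose.exists_mem_ne hX4 p p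
    have hnot : ∀ p ∈ X, ¬G.Adj v₀ p → ∀ v, trace G X T v = trace G X T v₀ → ¬G.Adj v p :=
      fun p hp hvp v hv hvp' => hvp ((hv ▸ (⟨Or.inl ⟨p, h.left.twin_self hp⟩, hvp'⟩ :
        p ∈ trace G X T v) : p ∈ trace G X T v₀)).2
    obtain ⟨SX, hSX, hSX'⟩ : ∃ S : Finset (Fin (n + (n + 2) / 3)), S.card ≤ 2 ∧
        ∀ u, HasTwin G X u → G.Adj v₀ u → g u ∈ S := by
      by_cases hx : ∃ x, Touch G X x v₀
      · obtain ⟨x, hx⟩ := hx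
        exact ⟨A (ρ x), hA2 _, fun u hu hvu => hrowX v₀ x u hv₀ hx hu hvu⟩
      · exact ⟨∅, by simp, fun u ⟨x, hu⟩ hvu => (hx ⟨x, u, hu, hvu⟩).elim⟩
    obtain ⟨ST, hST, hST'⟩ : ∃ S : Finset (Fin (n + (n + 2) / 3)), S.card ≤ 2 ∧
        ∀ u, HasTwin G T u → G.Adj v₀ u → g u ∈ S := by
      by_cases hx : ∃ x, Touch G T x v₀
      · obtain ⟨x, hx⟩ := hx
        exact ⟨B (σ x), hB2 _, fun u hu hvu => hrowT v₀ x u hv₀ hx hu hvu⟩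
      · exact ⟨∅, by simp, fun u ⟨x, hu⟩ hvu => (hx ⟨x, u, hu, hvu⟩).elim⟩
    have : Nonempty (Fin (n + (n + 2) / 3)) := ⟨⟨0, by omega⟩⟩
    have hcol := hG.exists_coloring (h.left.clique hp hq hqp.symm)
      (Finset.univ.filter fun c : Fin (n + (n + 2) / 3) => ∀ u ∈ trace G X T v₀, g u ≠ c)
      (Finset.univ.filter fun v => Outer G X T v ∧ trace G X T v = trace G X T v₀)
      (fun v hv => hnot p hp hvp v (Finset.mem_filter.1 hv).2.2)
      (fun v hv => hnot q hq hvq v (Finset.mem_filter.1 hv).2.2) ?_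
    · obtain ⟨f, hfL, hf⟩ := hcol
      refine ⟨f, fun v hv hvt => ⟨?_, fun w hw hwt hvw => ?_⟩⟩
      · rw [hvt]
        exact hfL v (by simpa using ⟨hv, hvt⟩)
      · exact hf v (by simpa using ⟨hv, hvt⟩) w (by simpa using ⟨hw, hwt⟩) hvw
    · intro K hKW hK
      have hKW' : ∀ v ∈ K, Outer G X T v ∧ trace G X T v = trace G X T v₀ :=
        fun v hv => (Finset.mem_filter.1 (hKW hv)).2
      by_cases hne : ∃ u, u ∈ trace G X T v₀
      · obtain ⟨u, hu⟩ := hne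
        have hK2 : K.card ≤ 2 := by
          by_contra! hK3
          obtain ⟨S, hSK, hS3⟩ := Finset.exists_subset_card_eq (s := K) (n := 3) hK3
          have hS : G.IsNClique 3 S := ⟨hK.subset fun s hs => hSK hs, hS3⟩
          have huS : ∀ s ∈ S, G.Adj u s := fun s hs => by
            have := (hKW' s (hSK hs)).2 ▸ hu
            exact this.2.symm
          rcases hu.1 with hu | hu
          · exact h.left.not_forall_adj hG h2 hS
              (fun s hs => (not_or.1 (hKW' s (hSK hs)).1).1) hu huS
          · exact h.right.not_forall_adj hG h2 hS
              (fun s hs => (not_or.1 (hKW' s (hSK hs)).1).2) hu huS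
        have hsub : (SX ∪ ST)ᶜ ⊆ Finset.univ.filter fun c : Fin (n + (n + 2) / 3) =>
            ∀ u ∈ trace G X T v₀, g u ≠ c := by
          intro c hc
          rw [Finset.mem_compl, Finset.mem_union, not_or] at hc
          rw [Finset.mem_filter]
          refine ⟨Finset.mem_univ _, ?_⟩
          rintro u ⟨hu | hu, hvu⟩ rfl
          · exact hc.1 (hSX' u hu hvu)
          · exact hc.2 (hST' u hu hvu)
        have h3 := Finset.card_le_card hsub
        rw [Finset.card_compl, Fintype.card_fin] at h3
        have h4 := Finset.card_union_le SX ST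
        omega
      · rw [Finset.filter_true_of_mem fun c _ u hu => (hne ⟨u, hu⟩).elim, Finset.card_univ,
          Fintype.card_fin]
        have := hn K hK
        omega

end CliquePair

end CliquePair

theorem exists_colorable_bound {V : Type*} [Fintype V] {G : SimpleGraph V} (hG : Good G) {n : ℕ}
    {K : Finset V} (hK : G.IsNClique n K) (hn4 : 4 ≤ n)
    (hn : ∀ K : Finset V, G.IsClique (K : Set V) → K.card ≤ n) :
    G.Colorable (n + (n + 2) / 3) := by
  by_cases h2 : HasTwoTriangles G
  · obtain ⟨X, T, x, hB⟩ := h2.exists_bouquet hG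
    exact (hB.colorable hG (n := n - 1) fun K hK => (hn K hK).trans (by omega)).mono (by omega)
  obtain ⟨X, -, hX⟩ := IsMaxClique.exists_superset hK.isClique (hK.card_eq ▸ hn4)
  by_cases hR : ∃ K : Finset V, (∀ v ∈ K, ¬HasTwin G X v) ∧ G.IsClique (K : Set V) ∧ 4 ≤ K.card
  · obtain ⟨K, hKX, hK, hK4⟩ := hR
    obtain ⟨T, hT⟩ := hX.exists_cliquePair hG h2 hK hK4 hKX
    exact hT.colorable hG h2 hn
  · push Not at hR
    exact (hX.colorable_of_rest hG hn fun K h1 h2 => Nat.lt_succ_iff.1 (hR K h1 h2)).mono (by omega)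

/-- If `G` is a finite simple `(P₂ ∪ P₄, HVN)`-free graph, then:
if `ω(G) = 2` then `χ(G) ≤ 4`; if `ω(G) = 3` then `χ(G) ≤ 10`; and
if `ω(G) ≥ 4` then `χ(G) ≤ ⌈(4/3)·ω(G)⌉`. -/
theorem chromatic_bound_P2P4_HVN_free {V : Type*} [Fintype V] (G : SimpleGraph V)
    (h1 : IsFree G P2P4) (h2 : IsFree G HVN) :
    (G.cliqueNum = 2 → G.chromaticNumber ≤ 4) ∧
    (G.cliqueNum = 3 → G.chromaticNumber ≤ 10) ∧
    (4 ≤ G.cliqueNum →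
      G.chromaticNumber ≤ (⌈(4 : ℚ) * G.cliqueNum / 3⌉₊ : ℕ∞)) := by
  classical
  have hG := Good.of_isFree h1 h2
  obtain ⟨K, hK⟩ := G.exists_isNClique_cliqueNum
  have hmax : ∀ K : Finset V, G.IsClique (K : Set V) → K.card ≤ G.cliqueNum :=
    fun K hK => hK.card_le_cliqueNum
  have hfree : ∀ n, G.cliqueNum < n → G.CliqueFree n := fun n hn S hS => by
    have := hmax S hS.isClique
    rw [hS.card_eq] at this
    omega
  refine ⟨fun h => ?_, fun h => ?_, fun h => ?_⟩
  · rw [h] at hK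
    obtain ⟨u, hu, v, hv, huv⟩ := Finset.one_lt_card.1 (hK.card_eq ▸ one_lt_two : 1 < K.card)
    exact (hG.colorable_four (hfree 3 (by omega)) (hK.isClique hu hv huv)).chromaticNumber_le
  · rw [h] at hK
    obtain ⟨a, b, c, hab, hac, hbc, -⟩ := is3Clique_iff.1 hK
    exact (hG.colorable_ten (hfree 4 (by omega)) hab hac hbc).chromaticNumber_le
  · refine (((exists_colorable_bound hG hK h hmax).mono ?_).chromaticNumber_le)
    have h3 := Nat.le_ceil ((4 : ℚ) * G.cliqueNum / 3)
    rw [div_le_iff₀ (by norm_num)] at h3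
    have h4 : 4 * G.cliqueNum ≤ ⌈(4 : ℚ) * G.cliqueNum / 3⌉₊ * 3 := by exact_mod_cast h3
    omega
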